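/- arXiv:2509.26052 — 7 statements merged into one kernel-verified Lean document; each statement's English description precedes it below -/
import Mathlib

section
/- (Classification of symplectic Lagrangian submodules.) Let N ≥ 1 and g ≥ 1. A ZMod N-submodule C of (ZMod N)^{2g} is Lagrangian with respect to η if and only if there exist positive integers d₁, …, d_g with d₁ ∣ d₂ ∣ ⋯ ∣ d_g and d_g² ∣ N, and a matrix γ ∈ Sp(2g, ℤ), such that C is the row span over ZMod N of the 2g×2g matrix diag(N/d₁, …, N/d_g, d₁, …, d_g) · γ̄, where γ̄ is the entrywise reduction of γ modulo N and the diagonal entries are cast into ZMod N. -/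
open Matrix

/-- The symplectic form `η` on `(ZMod N)^{2g}`:
`η(x,y) = ∑_{i=1}^g (x_{g+i} y_i − x_i y_{g+i})`. -/
def etaForm (N g : ℕ) (x y : Fin (2 * g) → ZMod N) : ZMod N :=
  ∑ i : Fin g,
    (x ⟨g + i.1, by have := i.2; omega⟩ * y ⟨i.1, by have := i.2; omega⟩ -
      x ⟨i.1, by have := i.2; omega⟩ * y ⟨g + i.1, by have := i.2; omega⟩)

/-- The block matrix `[[0, -I_g],[I_g, 0]]` of `η`, over `ℤ`. -/
def etaMatZ (g : ℕ) : Matrix (Fin (2 * g)) (Fin (2 * g)) ℤ :=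
  Matrix.of fun i j => if j.1 = i.1 + g then -1 else if i.1 = j.1 + g then 1 else 0

/-- Hyperbolic pairs `(e i, f i)`, `i < k`, for `B`, with positive multipliers `d i` such that
`d i • e i` and `(N / d i) • f i` lie in `L`, while every element of `L` orthogonal to all of
them takes only multiples of `d i` as values of `B`. -/
structure AdaptedFrame {M : Type*} [AddCommGroup M]
    (B : M →ₗ[ℤ] M →ₗ[ℤ] ℤ) (L : Submodule ℤ M)
    (N k : ℕ) (e f : ℕ → M) (d : ℕ → ℕ) : Prop where
  ee : ∀ i < k, ∀ j < k, B (e i) (e j) = 0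
  ff : ∀ i < k, ∀ j < k, B (f i) (f j) = 0
  ef : ∀ i < k, ∀ j < k, B (e i) (f j) = if i = j then 1 else 0
  pos : ∀ i < k, 0 < d i
  chain : ∀ i j, i ≤ j → j < k → d i ∣ d j
  sq_dvd : ∀ i < k, d i ^ 2 ∣ N
  mem_e : ∀ i < k, (d i : ℤ) • e i ∈ L
  mem_f : ∀ i < k, ((N / d i : ℕ) : ℤ) • f i ∈ L
  dvd : ∀ i < k, ∀ x ∈ L, (∀ j < k, B x (e j) = 0 ∧ B x (f j) = 0) → ∀ y, (d i : ℤ) ∣ B x y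

section

variable {M : Type*} [AddCommGroup M] {B : M →ₗ[ℤ] M →ₗ[ℤ] ℤ}

/-- The projection of `x` to the orthogonal complement of hyperbolic pairs `(e i, f i)`, `i < k`. -/
def hyperbolicCompl (B : M →ₗ[ℤ] M →ₗ[ℤ] ℤ) (k : ℕ) (e f : ℕ → M) (x : M) : M :=
  x - ∑ i ∈ Finset.range k, (B x (f i) • e i - B x (e i) • f i)

namespace AdaptedFrame

variable {L : Submodule ℤ M} {N k : ℕ} {e f : ℕ → M} {d : ℕ → ℕ}

lemma fe (hB : B.IsAlt) (h : AdaptedFrame B L N k e f d) {i j : ℕ} (hi : i < k) (hj : j < k) :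
    B (f i) (e j) = if i = j then -1 else 0 := by
  rw [← hB.neg, h.ef j hj i hi]
  split_ifs <;> omega

lemma hyperbolicCompl_orthogonal (hB : B.IsAlt) (h : AdaptedFrame B L N k e f d) (x : M) :
    ∀ j < k, B (hyperbolicCompl B k e f x) (e j) = 0 ∧
      B (hyperbolicCompl B k e f x) (f j) = 0 := by
  intro j hj
  simp only [hyperbolicCompl, map_sub, map_sum, map_smul, LinearMap.sub_apply,
    LinearMap.sum_apply, LinearMap.smul_apply, smul_eq_mul]
  constructor
  · rw [Finset.sum_eq_single_of_mem j (Finset.mem_range.2 hj)]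
    · rw [h.ee j hj j hj, h.fe hB hj hj]; simp
    · intro i hi hij
      rw [h.ee i (Finset.mem_range.1 hi) j hj, h.fe hB (Finset.mem_range.1 hi) hj]; simp [hij]
  · rw [Finset.sum_eq_single_of_mem j (Finset.mem_range.2 hj)]
    · rw [h.ff j hj j hj, h.ef j hj j hj]; simp
    · intro i hi hij
      rw [h.ff i (Finset.mem_range.1 hi) j hj, h.ef i (Finset.mem_range.1 hi) j hj]; simp [hij]

lemma apply_hyperbolicCompl {w : M}
    (hw : ∀ j < k, B w (e j) = 0 ∧ B w (f j) = 0) (x : M) :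
    B w (hyperbolicCompl B k e f x) = B w x := by
  simp only [hyperbolicCompl, map_sub, map_sum, map_smul, smul_eq_mul]
  rw [Finset.sum_eq_zero, sub_zero]
  intro i hi
  simp [hw i (Finset.mem_range.1 hi)]

lemma hyperbolicCompl_mem (hN : 0 < N) (hL : ∀ x, x ∈ L ↔ ∀ y ∈ L, (N : ℤ) ∣ B x y)
    (h : AdaptedFrame B L N k e f d) {x : M} (hx : x ∈ L) :
    hyperbolicCompl B k e f x ∈ L := by
  refine sub_mem hx (sum_mem fun i hi => ?_)
  have hi := Finset.mem_range.1 hi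
  have hd : d i ∣ N := (dvd_pow_self _ two_ne_zero).trans (h.sq_dvd i hi)
  have hpos : (d i : ℤ) ≠ 0 := by exact_mod_cast (h.pos i hi).ne'
  obtain ⟨m, rfl⟩ := hd
  have hm : d i * m / d i = m := Nat.mul_div_cancel_left _ (h.pos i hi)
  have he := (hL x).1 hx _ (h.mem_e i hi)
  have hf := (hL x).1 hx _ (h.mem_f i hi)
  have hfm := h.mem_f i hi
  have hem := h.mem_e i hi
  rw [hm] at hf hfm
  rw [map_smul, smul_eq_mul] at he hf
  push_cast at he hf
  have hm0 : (m : ℤ) ≠ 0 := by exact_mod_cast (Nat.pos_of_mul_pos_left hN).ne'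
  obtain ⟨a, ha⟩ := Int.dvd_of_mul_dvd_mul_left hpos he
  rw [mul_comm] at hf
  obtain ⟨b, hb⟩ := Int.dvd_of_mul_dvd_mul_left hm0 hf
  rw [ha, hb, mul_comm, mul_smul, mul_comm, mul_smul]
  exact sub_mem (L.smul_mem _ hem) (L.smul_mem _ hfm)

end AdaptedFrame

/-- A bi-additive integer pairing that does not vanish identically attains a positive value
dividing all the others. -/
lemma exists_apply_dvd_apply {P Q : Submodule ℤ M} (hne : ∃ x ∈ P, ∃ y ∈ Q, B x y ≠ 0) :
    ∃ x ∈ P, ∃ y ∈ Q, ∃ n : ℕ, 0 < n ∧ B x y = n ∧ ∀ x' ∈ P, ∀ y' ∈ Q, (n : ℤ) ∣ B x' y' := by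
  classical
  have hex : ∃ n : ℕ, 0 < n ∧ ∃ x ∈ P, ∃ y ∈ Q, B x y = n := by
    obtain ⟨x, hx, y, hy, h⟩ := hne
    rcases lt_or_gt_of_ne h with h | h
    · exact ⟨(B x y).natAbs, by omega, -x, neg_mem hx, y, hy,
        by rw [map_neg, LinearMap.neg_apply]; omega⟩
    · exact ⟨(B x y).natAbs, by omega, x, hx, y, hy, by omega⟩
  obtain ⟨hn, x₀, hx₀, y₀, hy₀, h₀⟩ := Nat.find_spec hex
  set n := Nat.find hex
  have hmin : ∀ x ∈ P, ∀ y ∈ Q, 0 ≤ B x y → B x y < n → B x y = 0 := by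
    intro x hx y hy h1 h2
    by_contra h3
    have := Nat.find_min' hex (m := (B x y).natAbs) ⟨by omega, x, hx, y, hy, by omega⟩
    omega
  have hn' : (0 : ℤ) < n := by exact_mod_cast hn
  have left : ∀ x ∈ P, ∀ y ∈ Q, B x y = n → ∀ x' ∈ P, (n : ℤ) ∣ B x' y := by
    intro x hx y hy hxy x' hx'
    have hmod : B (x' - (B x' y / n) • x) y = B x' y % n := by
      simp [hxy, Int.emod_def, mul_comm]
    have := hmin _ (sub_mem hx' (P.smul_mem (B x' y / n) hx)) y hy
    rw [hmod] at this
    exact Int.dvd_of_emod_eq_zero (this (Int.emod_nonneg _ hn'.ne') (Int.emod_lt_of_pos _ hn'))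
  have right : ∀ y' ∈ Q, (n : ℤ) ∣ B x₀ y' := by
    intro y' hy'
    have hmod : B x₀ (y' - (B x₀ y' / n) • y₀) = B x₀ y' % n := by
      simp [h₀, Int.emod_def, mul_comm]
    have := hmin _ hx₀ _ (sub_mem hy' (Q.smul_mem (B x₀ y' / n) hy₀))
    rw [hmod] at this
    exact Int.dvd_of_emod_eq_zero (this (Int.emod_nonneg _ hn'.ne') (Int.emod_lt_of_pos _ hn'))
  refine ⟨x₀, hx₀, y₀, hy₀, n, hn, h₀, fun x hx y hy => ?_⟩
  obtain ⟨a, ha⟩ := right y hy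
  have h1 := left x₀ hx₀ (y₀ + (y - a • y₀)) (add_mem hy₀ (sub_mem hy (Q.smul_mem a hy₀)))
    (by simp [h₀, ha, mul_comm]) x hx
  have h2 := left x₀ hx₀ y₀ hy₀ h₀ x hx
  have h3 : B x y = B x (y₀ + (y - a • y₀)) - (1 - a) * B x y₀ := by
    simp; ring
  rw [h3]
  exact dvd_sub h1 (h2.mul_left _)


lemma AdaptedFrame.exists_succ {L : Submodule ℤ M} {N k : ℕ} {e f : ℕ → M} {d : ℕ → ℕ}
    (hB : B.IsAlt) (hN : 0 < N) (hL : ∀ x, x ∈ L ↔ ∀ y ∈ L, (N : ℤ) ∣ B x y)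
    (hdiv : ∀ (x : M) (n : ℤ), (∀ y, n ∣ B x y) → ∃ v, x = n • v)
    (h : AdaptedFrame B L N k e f d)
    (hz : ∃ z, z ≠ 0 ∧ ∀ j < k, B z (e j) = 0 ∧ B z (f j) = 0) :
    ∃ e' f' d', AdaptedFrame B L N (k + 1) e' f' d' := by
  let W : Submodule ℤ M :=
    { carrier := {x | ∀ j < k, B x (e j) = 0 ∧ B x (f j) = 0}
      add_mem' := fun {a b} ha hb j hj => by simp [ha j hj, hb j hj]
      zero_mem' := fun j _ => by simp
      smul_mem' := fun c a ha j hj => by simp [ha j hj] }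
  have hWcompl (y : M) : hyperbolicCompl B k e f y ∈ W := h.hyperbolicCompl_orthogonal hB y
  have hNL (z : M) : (N : ℤ) • z ∈ L := (hL _).2 fun y _ => by simp
  have hne : ∃ x ∈ L ⊓ W, ∃ y ∈ W, B x y ≠ 0 := by
    obtain ⟨z, hz0, hzW⟩ := hz
    by_contra! hcon
    refine hz0 ?_
    obtain ⟨v, hv⟩ := hdiv z 0 fun y => by
      have := hcon ((N : ℤ) • z) ⟨hNL z, W.smul_mem _ hzW⟩ _ (hWcompl y)
      rw [map_smul, LinearMap.smul_apply, apply_hyperbolicCompl hzW, smul_eq_mul] at this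
      rw [zero_dvd_iff]
      exact (mul_eq_zero.1 this).resolve_left (by exact_mod_cast hN.ne')
    simpa using hv
  obtain ⟨x₀, ⟨hx₀L, hx₀W⟩, y₀, hy₀, n, hn, h₀, hdvd⟩ := exists_apply_dvd_apply hne
  have hn' : (n : ℤ) ≠ 0 := by exact_mod_cast hn.ne'
  have hdvdM (x : M) (hxL : x ∈ L) (hxW : x ∈ W) (y : M) : (n : ℤ) ∣ B x y := by
    rw [← apply_hyperbolicCompl hxW]
    exact hdvd x ⟨hxL, hxW⟩ _ (hWcompl y)
  obtain ⟨v, rfl⟩ := hdiv x₀ n (hdvdM x₀ hx₀L hx₀W)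
  have hv : v ∈ W := fun j hj => by simpa [hn.ne'] using hx₀W j hj
  have hvy : B v y₀ = 1 := mul_left_cancel₀ hn' (by simpa using h₀)
  have hyv : B y₀ v = -1 := by rw [← hB.neg, hvy]
  have hnN : n ∣ N := by
    have := hdvdM _ (hNL y₀) (W.smul_mem _ hy₀) v
    simpa [hyv, Int.natCast_dvd_natCast] using this
  obtain ⟨m, rfl⟩ := hnN
  have hm : n * m / n = m := Nat.mul_div_cancel_left _ hn
  have hmy : (m : ℤ) • y₀ ∈ L := by
    refine (hL _).2 fun x hx => ?_
    have hx' := hdvdM _ (h.hyperbolicCompl_mem hN hL hx) (hWcompl x) y₀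
    rw [← hB.neg, dvd_neg, apply_hyperbolicCompl hy₀] at hx'
    rw [map_smul, LinearMap.smul_apply, smul_eq_mul, Nat.cast_mul, mul_comm]
    exact mul_dvd_mul_left _ hx'
  have hnm : n ∣ m := by
    have := hdvdM _ hmy (W.smul_mem _ hy₀) v
    simpa [hyv, Int.natCast_dvd_natCast] using this
  have hk (a : ℕ → M) (b : M) : Function.update a k b k = b := by simp
  have hkd : Function.update d k n k = n := by simp
  have hltd {i : ℕ} (hi : i < k) : Function.update d k n i = d i :=
    Function.update_of_ne hi.ne _ _
  have hlt (a : ℕ → M) (b : M) {i : ℕ} (hi : i < k) :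
      Function.update a k b i = a i := Function.update_of_ne hi.ne _ _
  have hWsucc (x : M) (hx : ∀ j < k + 1, B x (Function.update e k v j) = 0 ∧
      B x (Function.update f k y₀ j) = 0) : x ∈ W := fun j hj => by
    have := hx j (by omega)
    rwa [hlt _ _ hj, hlt _ _ hj] at this
  refine ⟨Function.update e k v, Function.update f k y₀, Function.update d k n, ?_⟩
  refine ⟨?_, ?_, ?_, ?_, ?_, ?_, ?_, ?_, ?_⟩
  · intro i hi j hj
    rcases Nat.lt_succ_iff_lt_or_eq.1 hi with hi | rfl <;>
    rcases Nat.lt_succ_iff_lt_or_eq.1 hj with hj | rfl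
    · rw [hlt _ _ hi, hlt _ _ hj, h.ee i hi j hj]
    · rw [hlt _ _ hi, hk, ← hB.neg, (hv i hi).1, neg_zero]
    · rw [hlt _ _ hj, hk, (hv j hj).1]
    · rw [hk, hB.self_eq_zero]
  · intro i hi j hj
    rcases Nat.lt_succ_iff_lt_or_eq.1 hi with hi | rfl <;>
    rcases Nat.lt_succ_iff_lt_or_eq.1 hj with hj | rfl
    · rw [hlt _ _ hi, hlt _ _ hj, h.ff i hi j hj]
    · rw [hlt _ _ hi, hk, ← hB.neg, (hy₀ i hi).2, neg_zero]
    · rw [hlt _ _ hj, hk, (hy₀ j hj).2]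
    · rw [hk, hB.self_eq_zero]
  · intro i hi j hj
    rcases Nat.lt_succ_iff_lt_or_eq.1 hi with hi | rfl <;>
    rcases Nat.lt_succ_iff_lt_or_eq.1 hj with hj | rfl
    · rw [hlt _ _ hi, hlt _ _ hj, h.ef i hi j hj]
    · rw [hlt _ _ hi, hk, ← hB.neg, (hy₀ i hi).1, neg_zero, if_neg hi.ne]
    · rw [hlt _ _ hj, hk, (hv j hj).2, if_neg hj.ne']
    · rw [hk, hk, hvy, if_pos rfl]
  · intro i hi
    rcases Nat.lt_succ_iff_lt_or_eq.1 hi with hi | rfl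
    · rw [hltd hi]; exact h.pos i hi
    · rwa [hkd]
  · intro i j hij hj
    rcases Nat.lt_succ_iff_lt_or_eq.1 hj with hj | rfl
    · rw [hltd (hij.trans_lt hj), hltd hj]; exact h.chain i j hij hj
    · rcases hij.lt_or_eq with hi | rfl
      · rw [hltd hi, hkd]
        exact_mod_cast h₀ ▸ h.dvd i hi _ hx₀L hx₀W y₀
      · exact dvd_rfl
  · intro i hi
    rcases Nat.lt_succ_iff_lt_or_eq.1 hi with hi | rfl
    · rw [hltd hi]; exact h.sq_dvd i hi
    · rw [hkd, sq]; exact mul_dvd_mul_left _ hnm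
  · intro i hi
    rcases Nat.lt_succ_iff_lt_or_eq.1 hi with hi | rfl
    · rw [hltd hi, hlt _ _ hi]; exact h.mem_e i hi
    · rwa [hkd, hk]
  · intro i hi
    rcases Nat.lt_succ_iff_lt_or_eq.1 hi with hi | rfl
    · rw [hltd hi, hlt _ _ hi]; exact h.mem_f i hi
    · rwa [hkd, hk, hm]
  · intro i hi x hxL hx y
    rcases Nat.lt_succ_iff_lt_or_eq.1 hi with hi | rfl
    · rw [hltd hi]; exact h.dvd i hi x hxL (hWsucc x hx) y
    · rw [hkd]; exact hdvdM x hxL (hWsucc x hx) y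

end

/-- The two halves of `Fin (2 * g)`, as an equivalence with a sum type. -/
def halvesEquiv (g : ℕ) : Fin g ⊕ Fin g ≃ Fin (2 * g) :=
  finSumFinEquiv.trans (finCongr (two_mul g).symm)

lemma halvesEquiv_inl {g : ℕ} (i : Fin g) :
    halvesEquiv g (.inl i) = ⟨i.1, by have := i.2; omega⟩ := rfl

lemma halvesEquiv_inr {g : ℕ} (i : Fin g) :
    halvesEquiv g (.inr i) = ⟨g + i.1, by have := i.2; omega⟩ := rfl

lemma etaMatZ_eq_reindex (g : ℕ) :
    etaMatZ g = (J (Fin g) ℤ).reindex (halvesEquiv g) (halvesEquiv g) := by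
  ext i j
  obtain ⟨i, rfl⟩ := (halvesEquiv g).surjective i
  obtain ⟨j, rfl⟩ := (halvesEquiv g).surjective j
  rw [reindex_apply, submatrix_apply, Equiv.symm_apply_apply, Equiv.symm_apply_apply]
  rcases i with i | i <;> rcases j with j | j <;>
    simp [etaMatZ, J, halvesEquiv_inl, halvesEquiv_inr, Matrix.one_apply, Fin.ext_iff] <;> grind

section

variable {R : Type*} [CommRing R]

lemma etaMatZ_map_eq_reindex (R : Type*) [CommRing R] (g : ℕ) :
    (etaMatZ g).map (Int.cast : ℤ → R) =
      (J (Fin g) R).reindex (halvesEquiv g) (halvesEquiv g) := by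
  rw [etaMatZ_eq_reindex]
  ext i j
  obtain ⟨i, rfl⟩ := (halvesEquiv g).surjective i
  obtain ⟨j, rfl⟩ := (halvesEquiv g).surjective j
  rcases i with i | i <;> rcases j with j | j <;>
    simp [J, Matrix.one_apply]

lemma etaMatZ_map_mul_self (R : Type*) [CommRing R] (g : ℕ) :
    (etaMatZ g).map (Int.cast : ℤ → R) * (etaMatZ g).map (Int.cast : ℤ → R) = -1 := by
  rw [etaMatZ_map_eq_reindex, reindex_apply, submatrix_mul_equiv, J_squared]
  ext i j
  simp [Matrix.one_apply]

lemma vecMul_etaMatZ_inl {g : ℕ} (x : Fin (2 * g) → R) (i : Fin g) :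
    (x ᵥ* (etaMatZ g).map (Int.cast : ℤ → R)) (halvesEquiv g (.inl i)) =
      x (halvesEquiv g (.inr i)) := by
  rw [etaMatZ_map_eq_reindex, vecMul, dotProduct, ← (halvesEquiv g).sum_comp]
  simp [J, Matrix.one_apply]

lemma vecMul_etaMatZ_inr {g : ℕ} (x : Fin (2 * g) → R) (i : Fin g) :
    (x ᵥ* (etaMatZ g).map (Int.cast : ℤ → R)) (halvesEquiv g (.inr i)) =
      -x (halvesEquiv g (.inl i)) := by
  rw [etaMatZ_map_eq_reindex, vecMul, dotProduct, ← (halvesEquiv g).sum_comp]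
  simp [J, Matrix.one_apply]

lemma vecMul_etaMatZ_dotProduct {g : ℕ} (x y : Fin (2 * g) → R) :
    x ᵥ* (etaMatZ g).map (Int.cast : ℤ → R) ⬝ᵥ y =
      ∑ i : Fin g, (x ⟨g + i.1, by have := i.2; omega⟩ * y ⟨i.1, by have := i.2; omega⟩ -
        x ⟨i.1, by have := i.2; omega⟩ * y ⟨g + i.1, by have := i.2; omega⟩) := by
  rw [dotProduct, ← (halvesEquiv g).sum_comp, Fintype.sum_sum_type, ← Finset.sum_add_distrib]
  refine Finset.sum_congr rfl fun i _ => ?_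
  rw [vecMul_etaMatZ_inl, vecMul_etaMatZ_inr, halvesEquiv_inl, halvesEquiv_inr]
  ring

end

lemma etaForm_eq_dotProduct {N g : ℕ} (x y : Fin (2 * g) → ZMod N) :
    etaForm N g x y = x ᵥ* (etaMatZ g).map (Int.cast : ℤ → ZMod N) ⬝ᵥ y :=
  (vecMul_etaMatZ_dotProduct x y).symm

lemma ZMod.exists_eq_mul_of_mul_eq_zero {N a b : ℕ} (hN : 0 < N) (hab : a * b = N) {x : ZMod N}
    (hx : (a : ZMod N) * x = 0) : ∃ t : ZMod N, x = t * b := by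
  have : NeZero N := ⟨hN.ne'⟩
  rw [← ZMod.natCast_zmod_val x] at hx ⊢
  rw [← Nat.cast_mul, ZMod.natCast_eq_zero_iff] at hx
  replace hx := hab.dvd.trans hx
  have ha : 0 < a := by
    rcases Nat.eq_zero_or_pos a with rfl | h
    · simp at hab; omega
    · exact h
  obtain ⟨t, ht⟩ := Nat.dvd_of_mul_dvd_mul_left ha hx
  exact ⟨t, by rw [ht, Nat.cast_mul, mul_comm]⟩

section

variable {N g : ℕ}

/-- The entries of the matrix `diag(N/d₁, …, N/d_g, d₁, …, d_g)` over `ZMod N`. -/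
def elemDivisors (N : ℕ) {g : ℕ} (d : Fin g → ℕ) (i : Fin (2 * g)) : ZMod N :=
  if h : i.1 < g then ((N / d ⟨i.1, h⟩ : ℕ) : ZMod N)
  else ((d ⟨i.1 - g, by have := i.2; omega⟩ : ℕ) : ZMod N)

lemma elemDivisors_inl (d : Fin g → ℕ) (i : Fin g) :
    elemDivisors N d (halvesEquiv g (.inl i)) = (N / d i : ℕ) := by
  simp [elemDivisors, halvesEquiv_inl]

lemma elemDivisors_inr (d : Fin g → ℕ) (i : Fin g) :
    elemDivisors N d (halvesEquiv g (.inr i)) = d i := by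
  simp [elemDivisors, halvesEquiv_inr]

lemma diagonal_elemDivisors_mul_row (d : Fin g → ℕ)
    (G : Matrix (Fin (2 * g)) (Fin (2 * g)) (ZMod N)) (i : Fin (2 * g)) :
    (diagonal (elemDivisors N d) * G) i = elemDivisors N d i • G i := by
  ext j
  simp [diagonal_mul]

lemma etaForm_rows {G : Matrix (Fin (2 * g)) (Fin (2 * g)) (ZMod N)} (i j : Fin (2 * g)) :
    etaForm N g (G i) (G j) = (G * (etaMatZ g).map (Int.cast : ℤ → ZMod N) * Gᵀ) i j := by
  rw [etaForm_eq_dotProduct]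
  rfl

lemma etaForm_diagonal_rows_eq_zero {d : Fin g → ℕ} (hd : ∀ i, d i ∣ N)
    {G : Matrix (Fin (2 * g)) (Fin (2 * g)) (ZMod N)}
    (hG : G * (etaMatZ g).map (Int.cast : ℤ → ZMod N) * Gᵀ = (etaMatZ g).map Int.cast)
    (i j : Fin (2 * g)) :
    etaForm N g ((diagonal (elemDivisors N d) * G) i)
      ((diagonal (elemDivisors N d) * G) j) = 0 := by
  have key (i : Fin g) : ((N / d i : ℕ) : ZMod N) * d i = 0 := by
    rw [← Nat.cast_mul, Nat.div_mul_cancel (hd i), ZMod.natCast_self]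
  have key' (i : Fin g) : (d i : ZMod N) * (N / d i : ℕ) = 0 := by rw [mul_comm, key]
  rw [diagonal_elemDivisors_mul_row, diagonal_elemDivisors_mul_row, etaForm_eq_dotProduct,
    smul_vecMul, smul_dotProduct, dotProduct_smul, ← etaForm_eq_dotProduct, etaForm_rows, hG,
    etaMatZ_map_eq_reindex]
  obtain ⟨i, rfl⟩ := (halvesEquiv g).surjective i
  obtain ⟨j, rfl⟩ := (halvesEquiv g).surjective j
  rcases i with i | i <;> rcases j with j | j <;>
    simp only [elemDivisors_inl, elemDivisors_inr, reindex_apply, submatrix_apply,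
      Equiv.symm_apply_apply, smul_eq_mul] <;>
    simp [J, Matrix.one_apply] <;> rintro rfl <;> simp [key, key']

lemma mem_span_diagonal_rows (hN : 0 < N) {d : Fin g → ℕ} (hd : ∀ i, d i ∣ N)
    {G : Matrix (Fin (2 * g)) (Fin (2 * g)) (ZMod N)}
    (hG : G * (etaMatZ g).map (Int.cast : ℤ → ZMod N) * Gᵀ = (etaMatZ g).map Int.cast)
    {v : Fin (2 * g) → ZMod N}
    (hv : ∀ j, etaForm N g v ((diagonal (elemDivisors N d) * G) j) = 0) :
    v ∈ Submodule.span (ZMod N) (Set.range fun i => (diagonal (elemDivisors N d) * G) i) := by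
  set E := (etaMatZ g).map (Int.cast : ℤ → ZMod N) with hE
  have hinv : G * (E * Gᵀ * -E) = 1 := by
    rw [← Matrix.mul_assoc, ← Matrix.mul_assoc, hG, Matrix.mul_neg, hE, etaMatZ_map_mul_self,
      neg_neg]
  set c : Fin (2 * g) → ZMod N := v ᵥ* E ᵥ* Gᵀ with hc
  have hvc : v = -(c ᵥ* E) ᵥ* G := by
    rw [← vecMul_neg, hc]
    simp only [vecMul_vecMul, ← Matrix.mul_assoc] at hinv ⊢
    rw [Matrix.mul_assoc, Matrix.mul_assoc, mul_eq_one_comm] at hinv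
    rw [← Matrix.mul_assoc] at hinv
    rw [hinv, vecMul_one]
  have hcj (j) : elemDivisors N d j * c j = 0 := by
    have := hv j
    rwa [diagonal_elemDivisors_mul_row, etaForm_eq_dotProduct, dotProduct_smul] at this
  have hu (j) : ∃ t, (-(c ᵥ* E)) j = t * elemDivisors N d j := by
    obtain ⟨j, rfl⟩ := (halvesEquiv g).surjective j
    rcases j with i | i
    · have := hcj (halvesEquiv g (.inr i))
      rw [elemDivisors_inr] at this
      obtain ⟨t, ht⟩ := ZMod.exists_eq_mul_of_mul_eq_zero hN (Nat.mul_div_cancel' (hd i)) this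
      exact ⟨-t, by rw [Pi.neg_apply, vecMul_etaMatZ_inl, ht, elemDivisors_inl, neg_mul]⟩
    · have := hcj (halvesEquiv g (.inl i))
      rw [elemDivisors_inl] at this
      obtain ⟨t, ht⟩ := ZMod.exists_eq_mul_of_mul_eq_zero hN (Nat.div_mul_cancel (hd i)) this
      exact ⟨t, by rw [Pi.neg_apply, vecMul_etaMatZ_inr, ht, elemDivisors_inr, neg_neg]⟩
  rw [hvc, vecMul_eq_sum]
  refine sum_mem fun j _ => ?_
  obtain ⟨t, ht⟩ := hu j
  rw [ht, mul_smul, ← diagonal_elemDivisors_mul_row]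
  exact Submodule.smul_mem _ _ (Submodule.subset_span ⟨j, rfl⟩)

end

/-- The form with matrix `etaMatZ g`, as a bilinear map on `ℤ ^ (2 * g)`. -/
def etaBilin (g : ℕ) : (Fin (2 * g) → ℤ) →ₗ[ℤ] (Fin (2 * g) → ℤ) →ₗ[ℤ] ℤ :=
  Matrix.toLinearMap₂' ℤ (etaMatZ g)

lemma etaBilin_apply {g : ℕ} (x y : Fin (2 * g) → ℤ) :
    etaBilin g x y = x ᵥ* etaMatZ g ⬝ᵥ y := by
  rw [etaBilin, Matrix.toLinearMap₂'_apply', dotProduct_mulVec]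

lemma etaMatZ_map_intCast (g : ℕ) : (etaMatZ g).map (Int.cast : ℤ → ℤ) = etaMatZ g := by
  ext; simp

lemma etaBilin_apply_eq_sum {g : ℕ} (x y : Fin (2 * g) → ℤ) :
    etaBilin g x y =
      ∑ i : Fin g, (x ⟨g + i.1, by have := i.2; omega⟩ * y ⟨i.1, by have := i.2; omega⟩ -
        x ⟨i.1, by have := i.2; omega⟩ * y ⟨g + i.1, by have := i.2; omega⟩) := by
  rw [etaBilin_apply, ← vecMul_etaMatZ_dotProduct, etaMatZ_map_intCast]

lemma etaBilin_isAlt (g : ℕ) : (etaBilin g).IsAlt := fun x => by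
  rw [etaBilin_apply_eq_sum]
  exact Finset.sum_eq_zero fun i _ => by ring

lemma intCast_etaBilin {g : ℕ} (N : ℕ) (x y : Fin (2 * g) → ℤ) :
    ((etaBilin g x y : ℤ) : ZMod N) = etaForm N g (fun i => x i) (fun i => y i) := by
  rw [etaBilin_apply_eq_sum, etaForm]
  push_cast
  rfl

lemma exists_eq_smul_of_dvd_etaBilin {g : ℕ} (x : Fin (2 * g) → ℤ) (n : ℤ)
    (h : ∀ y, n ∣ etaBilin g x y) : ∃ v : Fin (2 * g) → ℤ, x = n • v := by
  have hdvd (j) : n ∣ x j := by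
    have key (k) : n ∣ (x ᵥ* (etaMatZ g).map (Int.cast : ℤ → ℤ)) k := by
      simpa [etaBilin_apply, etaMatZ_map_intCast] using h (Pi.single k 1)
    obtain ⟨j, rfl⟩ := (halvesEquiv g).surjective j
    rcases j with i | i
    · simpa only [vecMul_etaMatZ_inr, dvd_neg] using key (halvesEquiv g (.inr i))
    · simpa only [vecMul_etaMatZ_inl] using key (halvesEquiv g (.inl i))
  choose v hv using hdvd
  exact ⟨v, funext hv⟩

lemma exists_adaptedFrame {N g : ℕ} (hN : 0 < N) {L : Submodule ℤ (Fin (2 * g) → ℤ)}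
    (hL : ∀ x, x ∈ L ↔ ∀ y ∈ L, (N : ℤ) ∣ etaBilin g x y) :
    ∃ e f d, AdaptedFrame (etaBilin g) L N g e f d := by
  suffices H : ∀ k ≤ g, ∃ e f d, AdaptedFrame (etaBilin g) L N k e f d from H g le_rfl
  intro k
  induction k with
  | zero =>
    intro _
    exact ⟨0, 0, 0, by constructor <;> simp⟩
  | succ k ih =>
    intro hk
    obtain ⟨e, f, d, h⟩ := ih (by omega)
    refine h.exists_succ (etaBilin_isAlt g) hN hL exists_eq_smul_of_dvd_etaBilin ?_
    let T : (Fin (2 * g) → ℤ) →ₗ[ℤ] (Fin k ⊕ Fin k → ℤ) :=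
      LinearMap.pi (Sum.elim (fun j => (etaBilin g).flip (e j)) fun j => (etaBilin g).flip (f j))
    have hT : ¬ Function.Injective T := fun hT => by
      have := LinearMap.finrank_le_finrank_of_injective hT
      simp at this
      omega
    rw [injective_iff_map_eq_zero] at hT
    push Not at hT
    obtain ⟨z, hz, hz0⟩ := hT
    exact ⟨z, hz0, fun j hj => ⟨congrFun hz (.inl ⟨j, hj⟩), congrFun hz (.inr ⟨j, hj⟩)⟩⟩

/-- Classification of symplectic Lagrangian submodules: a `ZMod N`-submodule `C` of
`(ZMod N)^{2g}` is Lagrangian with respect to `η` iff it is the row span of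
`diag(N/d₁, …, N/d_g, d₁, …, d_g) · γ̄` for a divisibility chain `d₁ ∣ ⋯ ∣ d_g` with
`d_g² ∣ N` and some `γ ∈ Sp(2g, ℤ)`. -/
theorem symplectic_lagrangian_classification (N g : ℕ) (hN : 1 ≤ N) (hg : 1 ≤ g)
    (C : Submodule (ZMod N) (Fin (2 * g) → ZMod N)) :
    (∀ v, v ∈ C ↔ ∀ w ∈ C, etaForm N g v w = 0) ↔
    ∃ (d : Fin g → ℕ) (γ : Matrix (Fin (2 * g)) (Fin (2 * g)) ℤ),
      (∀ i, 0 < d i) ∧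
      (∀ i j : Fin g, i ≤ j → d i ∣ d j) ∧
      (d ⟨g - 1, by omega⟩) ^ 2 ∣ N ∧
      γ * etaMatZ g * γᵀ = etaMatZ g ∧
      C = Submodule.span (ZMod N)
        (Set.range fun i : Fin (2 * g) =>
          (Matrix.diagonal (fun i : Fin (2 * g) =>
              if h : i.1 < g then ((N / d ⟨i.1, h⟩ : ℕ) : ZMod N)
              else ((d ⟨i.1 - g, by have := i.2; omega⟩ : ℕ) : ZMod N)) *
            γ.map (Int.cast : ℤ → ZMod N)) i) := by
  have hmap {γ : Matrix (Fin (2 * g)) (Fin (2 * g)) ℤ} (hγ : γ * etaMatZ g * γᵀ = etaMatZ g) :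
      γ.map (Int.cast : ℤ → ZMod N) * (etaMatZ g).map Int.cast * (γ.map Int.cast)ᵀ =
        (etaMatZ g).map Int.cast := by
    have := congrArg (fun A => A.map (Int.castRingHom (ZMod N))) hγ
    simp only [Matrix.map_mul] at this
    exact this
  constructor
  · intro hC
    let L : Submodule ℤ (Fin (2 * g) → ℤ) :=
      { carrier := {x | (fun i => (x i : ZMod N)) ∈ C}
        add_mem' := fun {a b} ha hb => by
          simpa [Pi.add_def] using C.add_mem ha hb
        zero_mem' := by simpa [Pi.zero_def] using C.zero_mem
        smul_mem' := fun c a ha => by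
          simpa [Pi.smul_def] using C.smul_mem (c : ZMod N) ha }
    have hmemL (x) : x ∈ L ↔ (fun i => (x i : ZMod N)) ∈ C := Iff.rfl
    have hL (x) : x ∈ L ↔ ∀ y ∈ L, (N : ℤ) ∣ etaBilin g x y := by
      simp only [← ZMod.intCast_zmod_eq_zero_iff_dvd, intCast_etaBilin, hmemL]
      rw [hC]
      refine ⟨fun h y hy => h _ hy, fun h w hw => ?_⟩
      have hlift : (fun i => (((w i).cast : ℤ) : ZMod N)) = w := by ext; simp
      simpa only [hlift] using h (fun i => (w i).cast) (by rwa [hlift])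
    obtain ⟨e, f, d, h⟩ := exists_adaptedFrame hN hL
    let γ : Matrix (Fin (2 * g)) (Fin (2 * g)) ℤ := fun i =>
      Sum.elim (fun j : Fin g => f j) (fun j : Fin g => e j) ((halvesEquiv g).symm i)
    have hγl (i : Fin g) : γ (halvesEquiv g (.inl i)) = f i := by simp [γ]
    have hγr (i : Fin g) : γ (halvesEquiv g (.inr i)) = e i := by simp [γ]
    have hγ : γ * etaMatZ g * γᵀ = etaMatZ g := by
      ext i j
      have : (γ * etaMatZ g * γᵀ) i j = etaBilin g (γ i) (γ j) := by
        rw [etaBilin_apply]; rfl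
      rw [this, etaMatZ_eq_reindex]
      obtain ⟨i, rfl⟩ := (halvesEquiv g).surjective i
      obtain ⟨j, rfl⟩ := (halvesEquiv g).surjective j
      rcases i with i | i <;> rcases j with j | j <;>
        simp [hγl, hγr, J, Matrix.one_apply, h.ee, h.ff, h.ef, h.fe (etaBilin_isAlt g), Fin.ext_iff,
          apply_ite]
    have hdN (i : Fin g) : d i ∣ N := (dvd_pow_self _ two_ne_zero).trans (h.sq_dvd i i.2)
    refine ⟨fun i => d i, γ, fun i => h.pos i i.2, fun i j hij => h.chain i j hij j.2,
      h.sq_dvd _ (by omega), hγ, ?_⟩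
    have hrow (i : Fin (2 * g)) :
        (diagonal (elemDivisors N fun i : Fin g => d i) * γ.map (Int.cast : ℤ → ZMod N)) i ∈ C := by
      rw [diagonal_elemDivisors_mul_row]
      obtain ⟨i, rfl⟩ := (halvesEquiv g).surjective i
      rcases i with i | i
      · rw [elemDivisors_inl]
        convert (hmemL _).1 (h.mem_f i i.2) using 1
        ext j
        simp [← hγl, -Int.natCast_ediv]
      · rw [elemDivisors_inr]
        convert (hmemL _).1 (h.mem_e i i.2) using 1
        ext j
        simp [← hγr]
    refine le_antisymm (fun v hv => ?_) (Submodule.span_le.2 ?_)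
    · exact mem_span_diagonal_rows hN hdN (hmap hγ) fun j => (hC v).1 hv _ (hrow j)
    · rintro _ ⟨i, rfl⟩
      exact hrow i
  · rintro ⟨d, γ, -, hchain, hsq, hγ, rfl⟩ v
    have hdN (i : Fin g) : d i ∣ N :=
      (hchain i ⟨g - 1, by omega⟩ (Fin.mk_le_mk.2 (by omega) : (⟨i.1, i.2⟩ : Fin g) ≤ _)).trans
        ((dvd_pow_self _ two_ne_zero).trans hsq)
    refine ⟨fun hv w hw => ?_, fun hv => mem_span_diagonal_rows hN hdN (hmap hγ) fun j =>
      hv _ (Submodule.subset_span ⟨j, rfl⟩)⟩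
    simp only [etaForm_eq_dotProduct]
    induction hv, hw using Submodule.span_induction₂ with
    | mem_mem x y hx hy =>
      obtain ⟨i, rfl⟩ := hx
      obtain ⟨j, rfl⟩ := hy
      rw [← etaForm_eq_dotProduct]
      exact etaForm_diagonal_rows_eq_zero hdN (hmap hγ) i j
    | zero_left y hy => simp
    | zero_right x hx => simp
    | add_left x y z _ _ _ h1 h2 => rw [add_vecMul, add_dotProduct, h1, h2, add_zero]
    | add_right x y z _ _ _ h1 h2 => rw [dotProduct_add, h1, h2, add_zero]
    | smul_left r x y _ _ h1 => rw [smul_vecMul, smul_dotProduct, h1, smul_zero]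
    | smul_right r x y _ _ h1 => rw [dotProduct_smul, h1, smul_zero]
end

section
/- (Counting of symplectic orbits.) Let N ≥ 1 and g ≥ 1. The number of g-tuples (d₁, …, d_g) of positive integers satisfying d₁ ∣ d₂ ∣ ⋯ ∣ d_g and d_g² ∣ N equals ∏_{p ∈ primeFactors(N)} binomial(⌊s_p/2⌋ + g, g), where s_p denotes the multiplicity of the prime p in the factorization of N. -/
/-- Monotone maps `Fin g → α` correspond to multisets of size `g`, by sorting. -/
theorem bijective_orderHom_to_sym {α : Type*} [LinearOrder α] (g : ℕ) :
    Function.Bijective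
      (fun f : Fin g →o α => (⟨(List.ofFn f : Multiset α), by simp⟩ : Sym α g)) := by
  constructor
  · intro f f' h
    have hperm : (List.ofFn f).Perm (List.ofFn f') :=
      Multiset.coe_eq_coe.1 (congrArg Subtype.val h)
    have heq := hperm.eq_of_sortedLE (List.sortedLE_ofFn_iff.2 f.monotone)
      (List.sortedLE_ofFn_iff.2 f'.monotone)
    exact DFunLike.coe_injective (List.ofFn_injective heq)
  · rintro ⟨s, rfl⟩
    have hlen : s.card = (s.sort (· ≤ ·)).length := by simp
    have hofFn : List.ofFn (fun i : Fin s.card => (s.sort (· ≤ ·)).get (i.cast hlen)) =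
        s.sort (· ≤ ·) := by
      apply List.ext_get <;> simp
    refine ⟨⟨fun i => (s.sort (· ≤ ·)).get (i.cast hlen), ?_⟩, ?_⟩
    · rw [← List.sortedLE_ofFn_iff, hofFn]
      exact (s.pairwise_sort (· ≤ ·)).sortedLE
    · apply Subtype.ext
      simp only [OrderHom.coe_mk]
      rw [hofFn, Multiset.sort_eq]

theorem card_orderHom_fin (m g : ℕ) :
    Nat.card (Fin g →o Fin (m + 1)) = (m + g).choose g := by
  have hcard : Nat.card (Fin g →o Fin (m + 1)) = Nat.card (Sym (Fin (m + 1)) g) :=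
    Nat.card_congr (Equiv.ofBijective _ (bijective_orderHom_to_sym g))
  rw [hcard, Nat.card_eq_fintype_card, Sym.card_sym_eq_choose, Fintype.card_fin]
  congr 1
  omega

/-- A square divides `N` exactly when every exponent is at most half of the one in `N`. -/
theorem sq_dvd_iff_factorization_le_half {n N : ℕ} (hn : n ≠ 0) (hN : N ≠ 0) :
    n ^ 2 ∣ N ↔ ∀ p, n.factorization p ≤ N.factorization p / 2 := by
  rw [← Nat.factorization_le_iff_dvd (pow_ne_zero 2 hn) hN, Nat.factorization_pow,
    Finsupp.le_def]
  refine forall_congr' fun p => ?_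
  simp only [Finsupp.smul_apply, smul_eq_mul]
  omega

theorem exists_factorization_eq (N : ℕ) (e : N.primeFactors → ℕ) :
    ∃ n : ℕ, n ≠ 0 ∧ (∀ p : N.primeFactors, n.factorization p = e p) ∧
      ∀ p ∉ N.primeFactors, n.factorization p = 0 := by
  classical
  let f : ℕ →₀ ℕ := Finsupp.onFinset N.primeFactors
    (fun p => if h : p ∈ N.primeFactors then e ⟨p, h⟩ else 0)
    (fun p hp => by by_contra h; simp [h] at hp)
  have hsupp : ∀ p ∈ f.support, p.Prime := fun p hp =>
    Nat.prime_of_mem_primeFactors (Finsupp.support_onFinset_subset hp)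
  have hfact := Nat.prod_pow_factorization_eq_self hsupp
  refine ⟨f.prod (· ^ ·), ?_, fun p => ?_, fun p hp => ?_⟩
  · exact Finset.prod_ne_zero_iff.2 fun p hp => pow_ne_zero _ (hsupp p hp).ne_zero
  · rw [hfact, Finsupp.onFinset_apply, dif_pos p.2]
  · rw [hfact, Finsupp.onFinset_apply, dif_neg hp]

/-- Divisibility chains of square divisors of `N` correspond to families of monotone
exponent sequences, one for each prime factor of `N`. -/
theorem card_dvd_chain (N g : ℕ) (hN : N ≠ 0) (l : Fin g) (hl : ∀ i, i ≤ l) :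
    Nat.card {d : Fin g → ℕ //
      (∀ i, 0 < d i) ∧ (∀ i j : Fin g, i ≤ j → d i ∣ d j) ∧ d l ^ 2 ∣ N} =
    Nat.card ((p : N.primeFactors) → (Fin g →o Fin (N.factorization p / 2 + 1))) := by
  have hle (d : {d : Fin g → ℕ //
      (∀ i, 0 < d i) ∧ (∀ i j : Fin g, i ≤ j → d i ∣ d j) ∧ d l ^ 2 ∣ N}) (i : Fin g) (p : ℕ) :
      (d.1 i).factorization p ≤ N.factorization p / 2 :=
    (sq_dvd_iff_factorization_le_half (d.2.1 i).ne' hN).1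
      ((pow_dvd_pow_of_dvd (d.2.2.1 i l (hl i)) 2).trans d.2.2.2) p
  refine Nat.card_congr (Equiv.ofBijective (fun d p =>
    ⟨fun i => ⟨(d.1 i).factorization p, Nat.lt_succ_of_le (hle d i p)⟩, fun i j hij =>
      (Nat.factorization_le_iff_dvd (d.2.1 i).ne' (d.2.1 j).ne').2 (d.2.2.1 i j hij) p⟩)
    ⟨fun d d' h => ?_, fun F => ?_⟩)
  · apply Subtype.ext
    funext i
    apply Nat.eq_of_factorization_eq (d.2.1 i).ne' (d'.2.1 i).ne'
    intro p
    by_cases hp : p ∈ N.primeFactors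
    · exact congrArg Fin.val (DFunLike.congr_fun (congrFun h ⟨p, hp⟩) i)
    · have h0 : N.factorization p = 0 := by
        rwa [← Nat.support_factorization, Finsupp.notMem_support_iff] at hp
      have h1 := hle d i p
      have h2 := hle d' i p
      omega
  · choose d hd0 hdF hdN using fun i => exists_factorization_eq N (fun p => (F p i : ℕ))
    refine ⟨⟨d, fun i => (hd0 i).bot_lt, fun i j hij => ?_, ?_⟩, ?_⟩
    · rw [← Nat.factorization_le_iff_dvd (hd0 i) (hd0 j), Finsupp.le_def]
      intro p
      by_cases hp : p ∈ N.primeFactors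
      · rw [hdF i ⟨p, hp⟩, hdF j ⟨p, hp⟩]
        exact (F ⟨p, hp⟩).monotone hij
      · rw [hdN i p hp]
        exact Nat.zero_le _
    · rw [sq_dvd_iff_factorization_le_half (hd0 l) hN]
      intro p
      by_cases hp : p ∈ N.primeFactors
      · rw [hdF l ⟨p, hp⟩]
        exact Nat.le_of_lt_succ (F ⟨p, hp⟩ l).2
      · rw [hdN l p hp]
        exact Nat.zero_le _
    · funext p
      ext i
      exact hdF i p

/-- Counting of symplectic orbits: the number of `g`-tuples `(d₁, …, d_g)` of positive
integers with `d₁ ∣ d₂ ∣ ⋯ ∣ d_g` and `d_g² ∣ N` equals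
`∏_{p ∣ N prime} C(⌊s_p/2⌋ + g, g)` where `s_p` is the multiplicity of `p` in `N`. -/
theorem symplectic_orbit_count (N g : ℕ) (hN : 1 ≤ N) (hg : 1 ≤ g) :
    Nat.card {d : Fin g → ℕ //
      (∀ i, 0 < d i) ∧ (∀ i j : Fin g, i ≤ j → d i ∣ d j) ∧
      (d ⟨g - 1, by omega⟩) ^ 2 ∣ N} =
    ∏ p ∈ N.primeFactors, Nat.choose (N.factorization p / 2 + g) g := by
  rw [card_dvd_chain N g (by omega) _ fun i => Fin.le_def.2 (Nat.le_sub_one_of_lt i.2),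
    Nat.card_pi]
  simp only [card_orderHom_fin]
  exact Finset.prod_coe_sort N.primeFactors
    (fun p => Nat.choose (N.factorization p / 2 + g) g)
end

section
/- (Linear independence of q-Lagrangian stabilizer states.) Let p be an odd prime, m ≥ 1, n ≥ 1, and N = p^m. For each Lagrangian submodule L of (ZMod N)^{2n} with respect to the antidiagonal bilinear form b, and each g ≥ 1, define the function f_L : (Fin g → (ZMod N)^{2n}) → ℂ by f_L(x) = 1 if x(i) ∈ L for every i ∈ Fin g, and f_L(x) = 0 otherwise. Then for every g ≥ n, the family of functions {f_L}, indexed by the (distinct) Lagrangian submodules L of (ZMod N)^{2n}, is linearly independent over ℂ. -/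
/-- The antidiagonal bilinear form on `(ZMod N)^{2n}`:
`b(x,y) = ∑_{i=1}^{2n} x_i y_{2n+1−i}`. -/
def adForm (N n : ℕ) (x y : Fin (2 * n) → ZMod N) : ZMod N :=
  ∑ i, x i * y i.rev

theorem ZMod.exists_eq_pow_mul_of_pow_mul_eq_zero {p m k : ℕ} (hp : p.Prime) (hk : k ≤ m)
    {a : ZMod (p ^ m)} (h : (p : ZMod (p ^ m)) ^ k * a = 0) :
    ∃ b, a = (p : ZMod (p ^ m)) ^ (m - k) * b := by
  have : NeZero (p ^ m) := ⟨pow_ne_zero _ hp.ne_zero⟩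
  rw [← ZMod.natCast_zmod_val a] at h ⊢
  have h1 : ((p ^ k * a.val : ℕ) : ZMod (p ^ m)) = 0 := by push_cast; exact h
  rw [ZMod.natCast_eq_zero_iff] at h1
  have h2 : p ^ k * p ^ (m - k) ∣ p ^ k * a.val := by
    rwa [← pow_add, Nat.add_sub_cancel' hk]
  obtain ⟨c, hc⟩ := Nat.dvd_of_mul_dvd_mul_left (pow_pos hp.pos k) h2
  exact ⟨c, by rw [hc]; push_cast; rfl⟩

theorem ZMod.exists_eq_pow_smul_of_pow_smul_eq_zero {p m k : ℕ} {ι : Type*} (hp : p.Prime)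
    (hk : k ≤ m) {v : ι → ZMod (p ^ m)} (h : (p : ZMod (p ^ m)) ^ k • v = 0) :
    ∃ u, v = (p : ZMod (p ^ m)) ^ (m - k) • u := by
  choose u hu using fun i =>
    ZMod.exists_eq_pow_mul_of_pow_mul_eq_zero hp hk (a := v i) (by simpa using congrFun h i)
  exact ⟨u, funext hu⟩

/-- Reduction modulo `p`. -/
def redMod (p m : ℕ) (hm : 1 ≤ m) : ZMod (p ^ m) →+* ZMod p :=
  ZMod.castHom (dvd_pow_self p (Nat.one_le_iff_ne_zero.mp hm)) (ZMod p)

theorem redMod_eq_zero_of_pow_mul_eq_zero {p m e : ℕ} (hp : p.Prime) (hm : 1 ≤ m) (he : e < m)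
    {a : ZMod (p ^ m)} (h : (p : ZMod (p ^ m)) ^ e * a = 0) : redMod p m hm a = 0 := by
  obtain ⟨b, rfl⟩ := ZMod.exists_eq_pow_mul_of_pow_mul_eq_zero hp he.le h
  rw [map_mul, map_pow, map_natCast, ZMod.natCast_self, zero_pow (by omega), zero_mul]

theorem pow_mul_eq_zero_of_redMod_eq_zero {p m : ℕ} (hp : p.Prime) (hm : 1 ≤ m)
    {a : ZMod (p ^ m)} (h : redMod p m hm a = 0) : (p : ZMod (p ^ m)) ^ (m - 1) * a = 0 := by
  have : NeZero (p ^ m) := ⟨pow_ne_zero _ hp.ne_zero⟩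
  rw [← ZMod.natCast_zmod_val a, map_natCast, ZMod.natCast_eq_zero_iff] at h
  obtain ⟨c, hc⟩ := h
  rw [← ZMod.natCast_zmod_val a, hc, Nat.cast_mul, ← mul_assoc, ← pow_succ,
    Nat.sub_add_cancel hm, ← Nat.cast_pow, ZMod.natCast_self, zero_mul]

theorem adForm_smul_left (N n : ℕ) (c : ZMod N) (x y : Fin (2 * n) → ZMod N) :
    adForm N n (c • x) y = c * adForm N n x y := by
  simp [adForm, Finset.mul_sum, mul_assoc]

theorem adForm_smul_right (N n : ℕ) (c : ZMod N) (x y : Fin (2 * n) → ZMod N) :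
    adForm N n x (c • y) = c * adForm N n x y := by
  simp [adForm, Finset.mul_sum, mul_left_comm]

/-- The antidiagonal form as a bilinear form. -/
def adBilin (N n : ℕ) : LinearMap.BilinForm (ZMod N) (Fin (2 * n) → ZMod N) :=
  LinearMap.mk₂ (ZMod N) (adForm N n)
    (fun x x' y => by simp [adForm, add_mul, Finset.sum_add_distrib])
    (adForm_smul_left N n)
    (fun x y y' => by simp [adForm, mul_add, Finset.sum_add_distrib])
    (adForm_smul_right N n)

theorem adForm_comm (N n : ℕ) (x y : Fin (2 * n) → ZMod N) :
    adForm N n x y = adForm N n y x := by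
  unfold adForm
  rw [← Equiv.sum_comp Fin.revPerm]
  simp [mul_comm]

theorem adBilin_nondegenerate (N n : ℕ) : (adBilin N n).Nondegenerate := by
  have hleft : ∀ x, (∀ y, adForm N n x y = 0) → x = 0 := fun x hx => by
    funext i
    simpa [adForm, Pi.single_apply, Fin.rev_inj] using hx (Pi.single i.rev 1)
  exact ⟨hleft, fun y hy => hleft y fun x => (adForm_comm N n y x).trans (hy x)⟩

theorem finrank_le_of_adForm_eq_zero {p n : ℕ} [Fact p.Prime]
    (W : Submodule (ZMod p) (Fin (2 * n) → ZMod p))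
    (hW : ∀ v ∈ W, ∀ w ∈ W, adForm p n v w = 0) : Module.finrank (ZMod p) W ≤ n := by
  have h := LinearMap.BilinForm.finrank_orthogonal (adBilin_nondegenerate p n) W
  have hle : W ≤ (adBilin p n).orthogonal W := fun v hv w hw => hW w hw v hv
  have h2 := Submodule.finrank_mono hle
  have h3 := Submodule.finrank_le W
  rw [Module.finrank_fin_fun] at h h3
  omega

theorem redMod_adForm {p m n : ℕ} (hm : 1 ≤ m) (v w : Fin (2 * n) → ZMod (p ^ m)) :
    redMod p m hm (adForm (p ^ m) n v w) =
      adForm p n (fun i => redMod p m hm (v i)) (fun i => redMod p m hm (w i)) := by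
  simp [adForm]

/-- An elementary abelian `p`-group with at most `p ^ n` elements is generated by `n` elements. -/
theorem exists_closure_range_eq_top_of_zmodModule {Q : Type*} [AddCommGroup Q] [Finite Q]
    {p n : ℕ} (hp : p.Prime) [Module (ZMod p) Q] (hcard : Nat.card Q ≤ p ^ n) :
    ∃ s : Fin n → Q, AddSubgroup.closure (Set.range s) = ⊤ := by
  have : Fact p.Prime := ⟨hp⟩
  have hd : Module.finrank (ZMod p) Q ≤ n := by
    rw [Module.natCard_eq_pow_finrank (K := ZMod p), Nat.card_zmod] at hcard
    exact (Nat.pow_le_pow_iff_right hp.one_lt).mp hcard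
  let b := Module.finBasis (ZMod p) Q
  let s : Fin n → Q := fun i => if h : i.1 < Module.finrank (ZMod p) Q then b ⟨i, h⟩ else 0
  refine ⟨s, (AddSubgroup.eq_top_iff' _).mpr fun x => ?_⟩
  rw [← AddSubgroup.mem_toZModSubmodule p, ← b.sum_repr x]
  refine Submodule.sum_mem _ fun i _ => Submodule.smul_mem _ _ ?_
  exact AddSubgroup.subset_closure ⟨⟨i, i.2.trans_le hd⟩, by simp [s]⟩

/-- A finite abelian `p`-group whose `p`-torsion has at most `p ^ n` elements is generated by
`n` elements. -/
theorem exists_closure_range_eq_top {M : Type*} [AddCommGroup M] [Finite M] {p m n : ℕ}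
    (hp : p.Prime) (hM : ∀ x : M, p ^ m • x = 0)
    (hcard : Nat.card {x : M // p • x = 0} ≤ p ^ n) :
    ∃ s : Fin n → M, AddSubgroup.closure (Set.range s) = ⊤ := by
  let φ : M →+ M := nsmulAddMonoidHom p
  have hφ : ∀ x, φ x = p • x := fun x => rfl
  have hQ : Nat.card (M ⧸ φ.range) ≤ p ^ n := by
    have h1 := AddSubgroup.card_eq_card_quotient_mul_card_addSubgroup φ.range
    have h2 := AddSubgroup.card_eq_card_quotient_mul_card_addSubgroup φ.ker
    rw [Nat.card_congr (QuotientAddGroup.quotientKerEquivRange φ).toEquiv, h1, mul_comm] at h2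
    exact (Nat.eq_of_mul_eq_mul_left Nat.card_pos h2).trans_le hcard
  let _ : Module (ZMod p) (M ⧸ φ.range) := AddCommGroup.zmodModule fun x => by
    induction x using QuotientAddGroup.induction_on with
    | H x => exact (QuotientAddGroup.eq_zero_iff (p • x)).mpr ⟨x, rfl⟩
  obtain ⟨t, ht⟩ := exists_closure_range_eq_top_of_zmodModule hp hQ
  choose s hs using fun i => QuotientAddGroup.mk_surjective (t i)
  let H := AddSubgroup.closure (Set.range s)
  have hstep : ∀ x : M, ∃ h ∈ H, ∃ y, x = h + p • y := by
    intro x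
    have hx : (x : M ⧸ φ.range) ∈ H.map (QuotientAddGroup.mk' φ.range) := by
      rw [AddMonoidHom.map_closure, ← Set.range_comp,
        show QuotientAddGroup.mk' φ.range ∘ s = t from funext hs, ht]
      exact AddSubgroup.mem_top _
    obtain ⟨h, hh, hx⟩ := hx
    obtain ⟨y, hy⟩ := QuotientAddGroup.eq.mp hx
    exact ⟨h, hh, y, by rw [← hφ, hy]; abel⟩
  have hpow : ∀ k : ℕ, ∀ x : M, ∃ h ∈ H, ∃ y, x = h + p ^ k • y := by
    intro k
    induction k with
    | zero => exact fun x => ⟨0, H.zero_mem, x, by simp⟩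
    | succ k ih =>
      intro x
      obtain ⟨h, hh, y, rfl⟩ := ih x
      obtain ⟨h', hh', z, rfl⟩ := hstep y
      exact ⟨h + p ^ k • h', H.add_mem hh (H.nsmul_mem hh' _), z, by
        rw [smul_add, smul_smul, ← pow_succ, add_assoc]⟩
  refine ⟨s, (AddSubgroup.eq_top_iff' _).mpr fun x => ?_⟩
  obtain ⟨h, hh, y, rfl⟩ := hpow m x
  rw [hM, add_zero]
  exact hh

/-- If `L` is isotropic, then the `p`-torsion of `p ^ k L`, for `k ≥ (m - 1) / 2`, has at most
`p ^ n` elements. -/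
theorem card_torsion_map_smul_le {p m n k : ℕ} (hp : p.Prime) (hk : k < m) (hk2 : m ≤ 2 * k + 1)
    (L : Submodule (ZMod (p ^ m)) (Fin (2 * n) → ZMod (p ^ m)))
    (hL : ∀ v ∈ L, ∀ w ∈ L, adForm (p ^ m) n v w = 0) :
    Nat.card {x : L.map (LinearMap.lsmul (ZMod (p ^ m)) _ ((p : ZMod (p ^ m)) ^ k)) //
      p • x = 0} ≤ p ^ n := by
  have : Fact p.Prime := ⟨hp⟩
  have hm : 1 ≤ m := by omega
  set M := L.map (LinearMap.lsmul (ZMod (p ^ m)) (Fin (2 * n) → ZMod (p ^ m))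
    ((p : ZMod (p ^ m)) ^ k))
  let red : (Fin (2 * n) → ZMod (p ^ m)) →+ (Fin (2 * n) → ZMod p) :=
    (redMod p m hm).toAddMonoidHom.compLeft _
  let W : Submodule (ZMod p) (Fin (2 * n) → ZMod p) := AddSubgroup.toZModSubmodule p
    ((M.comap (LinearMap.lsmul (ZMod (p ^ m)) _
      ((p : ZMod (p ^ m)) ^ (m - 1)))).toAddSubgroup.map red)
  have hlift : ∀ v, (p : ZMod (p ^ m)) ^ (m - 1) • v ∈ M →
      ∃ u, red u = red v ∧ (p : ZMod (p ^ m)) ^ (m - 1 - k) • u ∈ L := by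
    rintro v ⟨l, hl, hlv⟩
    have h0 : (p : ZMod (p ^ m)) ^ k • (l - (p : ZMod (p ^ m)) ^ (m - 1 - k) • v) = 0 := by
      rw [smul_sub, smul_smul, ← pow_add, show k + (m - 1 - k) = m - 1 by omega, ← hlv]
      simp
    obtain ⟨u, hu⟩ := ZMod.exists_eq_pow_smul_of_pow_smul_eq_zero hp hk.le h0
    refine ⟨v + (p : ZMod (p ^ m)) • u, ?_, ?_⟩
    · funext i
      simp [red]
    · rw [smul_add, smul_smul, ← pow_succ, show m - 1 - k + 1 = m - k by omega, ← hu]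
      simpa using hl
  have hW : ∀ v ∈ W, ∀ w ∈ W, adForm p n v w = 0 := by
    rintro _ ⟨v, hv, rfl⟩ _ ⟨w, hw, rfl⟩
    obtain ⟨v', hv', hvL⟩ := hlift v hv
    obtain ⟨w', hw', hwL⟩ := hlift w hw
    have h := hL _ hvL _ hwL
    rw [adForm_smul_left, adForm_smul_right, ← mul_assoc, ← pow_add] at h
    have h' := redMod_eq_zero_of_pow_mul_eq_zero hp hm (by omega) h
    rw [redMod_adForm] at h'
    rw [← hv', ← hw']
    exact h'
  have hWcard : Nat.card W ≤ p ^ n := by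
    rw [Module.natCard_eq_pow_finrank (K := ZMod p), Nat.card_zmod]
    exact Nat.pow_le_pow_right hp.pos (finrank_le_of_adForm_eq_zero W hW)
  refine le_trans ?_ hWcard
  have hdiv : ∀ x : {x : M // p • x = 0}, ∃ u, (x.1 : Fin (2 * n) → ZMod (p ^ m)) =
      (p : ZMod (p ^ m)) ^ (m - 1) • u := fun x =>
    ZMod.exists_eq_pow_smul_of_pow_smul_eq_zero hp hm (by
      have h := congrArg Subtype.val x.2
      rw [pow_one, Nat.cast_smul_eq_nsmul]
      exact h)
  choose u hu using hdiv
  let f : {x : M // p • x = 0} → W := fun x =>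
    ⟨red (u x), u x, show (p : ZMod (p ^ m)) ^ (m - 1) • u x ∈ M from hu x ▸ x.1.2, rfl⟩
  refine Nat.card_le_card_of_injective f fun x y hxy => ?_
  have hxy' : red (u x) = red (u y) := congrArg Subtype.val hxy
  apply Subtype.ext
  apply Subtype.ext
  rw [hu x, hu y, ← sub_eq_zero, ← smul_sub]
  funext i
  refine pow_mul_eq_zero_of_redMod_eq_zero hp hm ?_
  rw [Pi.sub_apply, map_sub, sub_eq_zero]
  exact congrFun hxy' i

/-- An isotropic `L` contains `n` elements `x i` such that `p ^ k L` is generated by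
the `p ^ k x i`, provided `k ≥ (m - 1) / 2`. -/
theorem exists_map_span_range_eq {p m n k : ℕ} (hp : p.Prime) (hk : k < m) (hk2 : m ≤ 2 * k + 1)
    (L : Submodule (ZMod (p ^ m)) (Fin (2 * n) → ZMod (p ^ m)))
    (hL : ∀ v ∈ L, ∀ w ∈ L, adForm (p ^ m) n v w = 0) :
    ∃ x : Fin n → (Fin (2 * n) → ZMod (p ^ m)), (∀ i, x i ∈ L) ∧
      ∀ v ∈ L, ∃ y ∈ Submodule.span (ZMod (p ^ m)) (Set.range x),
        (p : ZMod (p ^ m)) ^ k • v = (p : ZMod (p ^ m)) ^ k • y := by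
  have : NeZero (p ^ m) := ⟨pow_ne_zero _ hp.ne_zero⟩
  obtain ⟨s, hs⟩ := exists_closure_range_eq_top (m := m) hp (fun x => by
    rw [← Nat.cast_smul_eq_nsmul (ZMod (p ^ m)), ZMod.natCast_self, zero_smul])
    (card_torsion_map_smul_le hp hk hk2 L hL)
  choose x hxL hx using fun i => (s i).2
  refine ⟨x, hxL, fun v hv => ?_⟩
  have hmem : ∀ z ∈ AddSubgroup.closure (Set.range s),
      ∃ y ∈ Submodule.span (ZMod (p ^ m)) (Set.range x),
        (z : Fin (2 * n) → ZMod (p ^ m)) = (p : ZMod (p ^ m)) ^ k • y := by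
    intro z hz
    induction hz using AddSubgroup.closure_induction with
    | mem z hz =>
      obtain ⟨i, rfl⟩ := hz
      exact ⟨x i, Submodule.subset_span ⟨i, rfl⟩, (hx i).symm⟩
    | zero => exact ⟨0, Submodule.zero_mem _, by simp⟩
    | add a b _ _ ha hb =>
      obtain ⟨y, hy, ha⟩ := ha
      obtain ⟨z, hz, hb⟩ := hb
      exact ⟨y + z, Submodule.add_mem _ hy hz, by simp [ha, hb]⟩
    | neg a _ ha =>
      obtain ⟨y, hy, ha⟩ := ha
      exact ⟨-y, Submodule.neg_mem _ hy, by simp [ha]⟩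
  exact hmem ⟨_, Submodule.mem_map_of_mem hv⟩ (hs ▸ AddSubgroup.mem_top _)

/-- If `L` is Lagrangian and `L'` is isotropic, and every element of `p ^ k L'` (with `2 k ≤ m`)
is `p ^ k y` for some `y ∈ L ⊓ L'`, and `p ^ k L ≤ p ^ k L'`, then `L' ≤ L`. -/
theorem le_of_pow_smul_eq {p m n k : ℕ} (hp : p.Prime) (hk : 2 * k ≤ m)
    {L L' : Submodule (ZMod (p ^ m)) (Fin (2 * n) → ZMod (p ^ m))}
    (hL : ∀ v, v ∈ L ↔ ∀ w ∈ L, adForm (p ^ m) n v w = 0)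
    (hL' : ∀ v ∈ L', ∀ w ∈ L', adForm (p ^ m) n v w = 0)
    (h₁ : ∀ v ∈ L', ∃ y ∈ L ⊓ L', (p : ZMod (p ^ m)) ^ k • v = (p : ZMod (p ^ m)) ^ k • y)
    (h₂ : ∀ v ∈ L, ∃ y ∈ L', (p : ZMod (p ^ m)) ^ k • v = (p : ZMod (p ^ m)) ^ k • y) :
    L' ≤ L := by
  intro v hv
  obtain ⟨y, ⟨hyL, hyL'⟩, hvy⟩ := h₁ v hv
  obtain ⟨u, hu⟩ := ZMod.exists_eq_pow_smul_of_pow_smul_eq_zero (v := v - y) (k := k) hp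
    (by omega) (by rw [smul_sub, hvy, sub_self])
  suffices h : v - y ∈ L by simpa using L.add_mem h hyL
  refine (hL _).mpr fun l hl => ?_
  obtain ⟨l', hl', hll'⟩ := h₂ l hl
  have h := hL' _ (L'.sub_mem hv hyL') l' hl'
  rw [hu, adForm_smul_left, ← adForm_smul_right, show m - k = m - 2 * k + k by omega, pow_add,
    mul_smul] at h ⊢
  rwa [hll']

/-- Linear independence of `q`-Lagrangian stabilizer states: for `N = p^m` (`p` an odd
prime) and `g ≥ n`, the indicator functions on `(Fin g → (ZMod N)^{2n})` of "all
components lie in `L`", indexed by the Lagrangian submodules `L` of `(ZMod N)^{2n}`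
with respect to the antidiagonal form, are linearly independent over `ℂ`. -/
theorem qLagrangian_states_linearIndependent (p m n g : ℕ) (hp : p.Prime) (hodd : Odd p)
    (hm : 1 ≤ m) (hn : 1 ≤ n) (hg : n ≤ g) :
    LinearIndependent ℂ
      (fun L : {L : Submodule (ZMod (p ^ m)) (Fin (2 * n) → ZMod (p ^ m)) //
          ∀ v, v ∈ L ↔ ∀ w ∈ L, adForm (p ^ m) n v w = 0} =>
        Set.indicator
          {x : Fin g → (Fin (2 * n) → ZMod (p ^ m)) | ∀ i, x i ∈ L.1}
          (fun _ => (1 : ℂ))) := by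
  classical
  have : NeZero (p ^ m) := ⟨pow_ne_zero _ hp.ne_zero⟩
  rw [linearIndependent_iff']
  intro s c hsum
  by_contra! hne
  obtain ⟨L₀, hL₀s, hL₀c⟩ := hne
  let k := m / 2
  let P := LinearMap.lsmul (ZMod (p ^ m)) (Fin (2 * n) → ZMod (p ^ m)) ((p : ZMod (p ^ m)) ^ k)
  obtain ⟨L, hLmem, hLmax⟩ := Finset.exists_max_image (s.filter fun L => c L ≠ 0)
    (fun L => Nat.card (L.1.map P)) ⟨L₀, by simp [hL₀s, hL₀c]⟩
  rw [Finset.mem_filter] at hLmem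
  have hiso : ∀ L : {L : Submodule (ZMod (p ^ m)) (Fin (2 * n) → ZMod (p ^ m)) //
      ∀ v, v ∈ L ↔ ∀ w ∈ L, adForm (p ^ m) n v w = 0},
      ∀ v ∈ L.1, ∀ w ∈ L.1, adForm (p ^ m) n v w = 0 := fun L v hv => (L.2 v).mp hv
  obtain ⟨x, hxL, hx⟩ := exists_map_span_range_eq (k := k) hp (by omega) (by omega) L.1 (hiso L)
  let x' : Fin g → (Fin (2 * n) → ZMod (p ^ m)) := fun i => if h : i.1 < n then x ⟨i, h⟩ else 0
  have hx' : ∀ L' : Submodule (ZMod (p ^ m)) (Fin (2 * n) → ZMod (p ^ m)),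
      (∀ i, x' i ∈ L') ↔ Submodule.span (ZMod (p ^ m)) (Set.range x) ≤ L' := by
    intro L'
    rw [Submodule.span_le, Set.range_subset_iff]
    constructor
    · intro h i
      simpa [x'] using h ⟨i, i.2.trans_le hg⟩
    · intro h i
      by_cases hi : i.1 < n
      · simpa [x', hi] using h ⟨i, hi⟩
      · simp [x', hi]
  have hspan : Submodule.span (ZMod (p ^ m)) (Set.range x) ≤ L.1 :=
    Submodule.span_le.mpr (Set.range_subset_iff.mpr hxL)
  have huniq : ∀ L' ∈ s, c L' ≠ 0 → (∀ i, x' i ∈ L'.1) → L' = L := by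
    intro L' hL's hcL' hxL'
    rw [hx'] at hxL'
    have hle : L.1.map P ≤ L'.1.map P := by
      rintro _ ⟨v, hv, rfl⟩
      obtain ⟨y, hy, hvy⟩ := hx v hv
      exact ⟨y, hxL' hy, hvy.symm⟩
    have hge : L'.1.map P ≤ L.1.map P :=
      (SetLike.coe_injective (Set.eq_of_subset_of_ncard_le hle
        (hLmax L' (by simp [hL's, hcL'])) (Set.toFinite _))).ge
    have hL'L : L'.1 ≤ L.1 := by
      refine le_of_pow_smul_eq (k := k) hp (by omega) L.2 (hiso L') ?_ ?_
      · intro v hv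
        obtain ⟨w, hw, hwv⟩ := hge (Submodule.mem_map_of_mem hv)
        obtain ⟨y, hy, hwy⟩ := hx w hw
        exact ⟨y, ⟨hspan hy, hxL' hy⟩, hwv.symm.trans hwy⟩
      · intro v hv
        obtain ⟨y, hy, hvy⟩ := hx v hv
        exact ⟨y, hxL' hy, hvy⟩
    exact Subtype.ext (le_antisymm hL'L fun v hv =>
      (L'.2 v).mpr fun w hw => hiso L v hv w (hL'L hw))
  have heval := congrFun hsum x'
  rw [Finset.sum_apply, Finset.sum_eq_single_of_mem L hLmem.1] at heval
  · rw [Pi.smul_apply, Set.indicator_of_mem (show x' ∈ {x : Fin g → _ | ∀ i, x i ∈ L.1} from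
      (hx' L.1).mpr hspan)] at heval
    exact hLmem.2 (by simpa using heval)
  · intro L' hL's hL'
    by_cases hcL' : c L' = 0
    · simp [hcL']
    · rw [Pi.smul_apply, Set.indicator_of_notMem, smul_zero]
      exact fun h => hL' (huniq L' hL's hcL' h)
end

section
/- Let p be a prime, m ≥ 1, n ≥ 1, and 0 ≤ k ≤ m. Let L be a Lagrangian submodule of (ZMod p^m)^{2n} with respect to the antidiagonal bilinear form b. If the first coordinate of every element of L is divisible by p^k (i.e. for every v ∈ L, v₁ lies in the subgroup p^k · (ZMod p^m)), then the vector whose last (2n-th) coordinate is p^{m−k} and whose other coordinates are 0 belongs to L. -/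
/-- If every element of a Lagrangian submodule `L ⊆ (ZMod p^m)^{2n}` (for the
antidiagonal form) has first coordinate divisible by `p^k`, then the vector whose last
coordinate is `p^{m−k}` and other coordinates `0` belongs to `L`. -/
theorem last_coordinate_vector_mem (p m n k : ℕ) (hp : p.Prime) (hm : 1 ≤ m)
    (hn : 1 ≤ n) (hk : k ≤ m)
    (L : Submodule (ZMod (p ^ m)) (Fin (2 * n) → ZMod (p ^ m)))
    (hL : ∀ v, v ∈ L ↔ ∀ w ∈ L, adForm (p ^ m) n v w = 0)
    (hdiv : ∀ v ∈ L, ∃ x : ZMod (p ^ m),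
      v ⟨0, by omega⟩ = (p : ZMod (p ^ m)) ^ k * x) :
    (fun i : Fin (2 * n) =>
      if i.1 = 2 * n - 1 then (p : ZMod (p ^ m)) ^ (m - k) else 0) ∈ L := by
  rw [hL]
  intro w hw
  obtain ⟨x, hx⟩ := hdiv w hw
  unfold adForm
  rw [Finset.sum_eq_single (⟨2 * n - 1, by omega⟩ : Fin (2 * n))]
  · have hrev : (⟨2 * n - 1, by omega⟩ : Fin (2 * n)).rev = ⟨0, by omega⟩ := by
      ext
      simp only [Fin.val_rev]
      omega
    have hpow : (p : ZMod (p ^ m)) ^ m = 0 := by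
      exact_mod_cast ZMod.natCast_self (p ^ m)
    beta_reduce
    rw [hrev, hx, if_pos rfl, ← mul_assoc, ← pow_add, Nat.sub_add_cancel hk, hpow, zero_mul]
  · intro i _ hi
    have hval : i.1 ≠ 2 * n - 1 := fun h => hi (Fin.ext h)
    beta_reduce
    rw [if_neg hval, zero_mul]
  · exact fun h => absurd (Finset.mem_univ _) h
end

section
/- Let p be a prime, m ≥ 1, and n ≥ 1. If L is a Lagrangian submodule of (ZMod p^m)^{2n} with respect to the antidiagonal bilinear form b, then it is not the case that every coordinate of every element of L is divisible by p^{⌊m/2⌋ + 1}; i.e., there exist v ∈ L and a coordinate index i such that v_i does not lie in the subgroup p^{⌊m/2⌋+1} · (ZMod p^m). -/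
/-- For a Lagrangian submodule `L ⊆ (ZMod p^m)^{2n}` (antidiagonal form) it is not the
case that every coordinate of every element of `L` is divisible by `p^{⌊m/2⌋+1}`:
there are `v ∈ L` and a coordinate `i` with `v i` not of the form `p^{⌊m/2⌋+1}·x`. -/
theorem lagrangian_not_all_divisible (p m n : ℕ) (hp : p.Prime) (hm : 1 ≤ m) (hn : 1 ≤ n)
    (L : Submodule (ZMod (p ^ m)) (Fin (2 * n) → ZMod (p ^ m)))
    (hL : ∀ v, v ∈ L ↔ ∀ w ∈ L, adForm (p ^ m) n v w = 0) :
    ∃ v ∈ L, ∃ i : Fin (2 * n),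
      ¬ ∃ x : ZMod (p ^ m), v i = (p : ZMod (p ^ m)) ^ (m / 2 + 1) * x := by
  by_contra! h
  set P : ZMod (p ^ m) := (p : ZMod (p ^ m)) with hP
  have pow_zero_of_le : ∀ k, m ≤ k → P ^ k = 0 := fun k hk => by
    rw [hP, ← Nat.cast_pow, ZMod.natCast_eq_zero_iff]
    exact pow_dvd_pow p hk
  let i₀ : Fin (2 * n) := ⟨0, by lia⟩
  -- The vector `p ^ (m - m / 2 - 1) • e₀` is orthogonal to `L`, hence lies in `L`.
  have hmem : Pi.single i₀ (P ^ (m - m / 2 - 1)) ∈ L := by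
    rw [hL]
    intro w hw
    obtain ⟨x, hx⟩ := h w hw i₀.rev
    rw [adForm, Finset.sum_eq_single i₀ (fun j _ hj => by simp [hj]) (by simp),
      Pi.single_eq_same, hx, ← mul_assoc, ← pow_add, pow_zero_of_le _ (by lia), zero_mul]
  obtain ⟨x, hx⟩ := h _ hmem i₀
  rw [Pi.single_eq_same] at hx
  have hzero : P ^ (m - 1) = 0 := by
    calc P ^ (m - 1) = P ^ (m / 2) * P ^ (m - m / 2 - 1) := by
          rw [← pow_add]; congr 1; lia
      _ = 0 := by
          rw [hx, ← mul_assoc, ← pow_add, pow_zero_of_le _ (by lia), zero_mul]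
  rw [hP, ← Nat.cast_pow, ZMod.natCast_eq_zero_iff, Nat.pow_dvd_pow_iff_le_right hp.one_lt] at hzero
  lia
end

section
/- (Classification of surface operators for G = Z_{p^m}.) Let p be an odd prime and m ≥ 1. For 0 ≤ k ≤ ⌊m/2⌋ let L_k ⊆ (ZMod p^m)² be the submodule spanned by (p^k, p^k) and (0, p^{m−k}), and for ⌊m/2⌋ < k ≤ m let L_k be the submodule spanned by (p^{m−k}, −p^{m−k}) and (0, p^k). Then a ZMod p^m-submodule L of (ZMod p^m)² is Lagrangian with respect to the bilinear form b((a,b),(c,d)) = a·c − b·d if and only if L = L_k for some 0 ≤ k ≤ m; moreover the submodules L₀, …, L_m are pairwise distinct, so there are exactly m + 1 Lagrangian submodules. -/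
/-- The submodules `L_k` of `(ZMod p^m)²`: for `k ≤ ⌊m/2⌋`, the span of `(p^k, p^k)` and
`(0, p^{m−k})`; for `k > ⌊m/2⌋`, the span of `(p^{m−k}, −p^{m−k})` and `(0, p^k)`. -/
def Lk (p m k : ℕ) : Submodule (ZMod (p ^ m)) (ZMod (p ^ m) × ZMod (p ^ m)) :=
  if k ≤ m / 2 then
    Submodule.span (ZMod (p ^ m))
      {((p : ZMod (p ^ m)) ^ k, (p : ZMod (p ^ m)) ^ k),
       (0, (p : ZMod (p ^ m)) ^ (m - k))}
  else
    Submodule.span (ZMod (p ^ m))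
      {((p : ZMod (p ^ m)) ^ (m - k), -((p : ZMod (p ^ m)) ^ (m - k))),
       (0, (p : ZMod (p ^ m)) ^ k)}

namespace ZMod

variable {p m : ℕ}

lemma primePow_natCast_pow_self : (p : ZMod (p ^ m)) ^ m = 0 := by
  exact_mod_cast ZMod.natCast_self (p ^ m)

lemma primePow_natCast_pow_eq_zero_iff (hp : p.Prime) {i : ℕ} :
    (p : ZMod (p ^ m)) ^ i = 0 ↔ m ≤ i := by
  rw [← Nat.cast_pow, ZMod.natCast_eq_zero_iff, Nat.pow_dvd_pow_iff_le_right hp.one_lt]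

lemma exists_eq_primePow_mul_isUnit (hp : p.Prime) (x : ZMod (p ^ m)) :
    ∃ i ≤ m, ∃ c : ZMod (p ^ m), IsUnit c ∧ x = (p : ZMod (p ^ m)) ^ i * c := by
  have : NeZero (p ^ m) := ⟨pow_ne_zero _ hp.ne_zero⟩
  rcases eq_or_ne x 0 with rfl | hx
  · exact ⟨m, le_rfl, 1, isUnit_one, by rw [primePow_natCast_pow_self, zero_mul]⟩
  · have hv : x.val ≠ 0 := (ZMod.val_ne_zero x).mpr hx
    obtain ⟨i, c, hc, h⟩ := Nat.exists_eq_pow_mul_and_not_dvd hv p hp.ne_one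
    have hxe : x = (p : ZMod (p ^ m)) ^ i * c := by
      rw [← ZMod.natCast_zmod_val x, h]
      push_cast
      rfl
    refine ⟨i, ?_, c, ?_, hxe⟩
    · by_contra! hi
      exact hx (by rw [hxe, (primePow_natCast_pow_eq_zero_iff hp).mpr hi.le, zero_mul])
    · exact (ZMod.isUnit_iff_coprime c (p ^ m)).mpr
        (((Nat.Prime.coprime_iff_not_dvd hp).mpr hc).symm.pow_right m)

lemma primePow_dvd_total (hp : p.Prime) (x y : ZMod (p ^ m)) : x ∣ y ∨ y ∣ x := by
  obtain ⟨i, -, c, hc, rfl⟩ := exists_eq_primePow_mul_isUnit hp x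
  obtain ⟨j, -, d, hd, rfl⟩ := exists_eq_primePow_mul_isUnit hp y
  rw [hc.mul_right_dvd, hd.mul_right_dvd]
  exact (le_total i j).imp (fun h => (pow_dvd_pow _ h).mul_right d)
    fun h => (pow_dvd_pow _ h).mul_right c

lemma primePow_dvd_of_mul_eq_zero (hp : p.Prime) {i : ℕ} {x : ZMod (p ^ m)}
    (h : (p : ZMod (p ^ m)) ^ i * x = 0) : (p : ZMod (p ^ m)) ^ (m - i) ∣ x := by
  obtain ⟨j, -, c, hc, rfl⟩ := exists_eq_primePow_mul_isUnit hp x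
  rw [← mul_assoc, ← pow_add, hc.mul_left_eq_zero, primePow_natCast_pow_eq_zero_iff hp] at h
  exact (pow_dvd_pow _ (by omega)).mul_right c

lemma mul_eq_zero_of_primePow_dvd {k : ℕ} (hk : k ≤ m) {x y : ZMod (p ^ m)}
    (hx : (p : ZMod (p ^ m)) ^ k ∣ x) (hy : (p : ZMod (p ^ m)) ^ (m - k) ∣ y) : x * y = 0 := by
  have h := mul_dvd_mul hx hy
  rwa [← pow_add, Nat.add_sub_cancel' hk, primePow_natCast_pow_self, zero_dvd_iff] at h

lemma le_of_primePow_dvd_primePow (hp : p.Prime) {i j : ℕ} (hi : i ≤ m)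
    (h : (p : ZMod (p ^ m)) ^ i ∣ (p : ZMod (p ^ m)) ^ j) : i ≤ j := by
  have h0 := mul_eq_zero_of_primePow_dvd hi h dvd_rfl
  rw [← pow_add, primePow_natCast_pow_eq_zero_iff hp] at h0
  omega

lemma exists_mem_ideal_iff_primePow_dvd (hp : p.Prime) (I : Ideal (ZMod (p ^ m))) :
    ∃ k ≤ m, ∀ x, x ∈ I ↔ (p : ZMod (p ^ m)) ^ k ∣ x := by
  classical
  have hex : ∃ k, (p : ZMod (p ^ m)) ^ k ∈ I :=
    ⟨m, by rw [primePow_natCast_pow_self]; exact I.zero_mem⟩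
  refine ⟨Nat.find hex, Nat.find_le ?_, fun x => ⟨fun hx => ?_, fun hx => ?_⟩⟩
  · rw [primePow_natCast_pow_self]; exact I.zero_mem
  · obtain ⟨i, -, c, hc, rfl⟩ := exists_eq_primePow_mul_isUnit hp x
    exact (pow_dvd_pow _ (Nat.find_min' hex ((I.mul_unit_mem_iff_mem hc).mp hx))).mul_right c
  · exact I.mem_of_dvd hx (Nat.find_spec hex)

lemma isUnit_two_primePow (hodd : Odd p) : IsUnit (2 : ZMod (p ^ m)) := by
  have h := (ZMod.isUnit_iff_coprime 2 (p ^ m)).mpr (Nat.coprime_two_left.mpr hodd.pow)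
  exact_mod_cast h

end ZMod

open ZMod

lemma mem_Lk_iff {p m k : ℕ} (hodd : Odd p) (hk : k ≤ m)
    (v : ZMod (p ^ m) × ZMod (p ^ m)) :
    v ∈ Lk p m k ↔
      (p : ZMod (p ^ m)) ^ k ∣ v.1 + v.2 ∧ (p : ZMod (p ^ m)) ^ (m - k) ∣ v.1 - v.2 := by
  obtain ⟨x, y⟩ := v
  obtain ⟨h, hh⟩ := (isUnit_two_primePow (m := m) hodd).exists_right_inv
  unfold Lk
  split_ifs with hkm
  · obtain ⟨d, hd⟩ := pow_dvd_pow (p : ZMod (p ^ m)) (show k ≤ m - k by omega)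
    simp only [Submodule.mem_span_pair, Prod.smul_mk, Prod.mk_add_mk, smul_eq_mul, Prod.mk.injEq]
    constructor
    · rintro ⟨a, b, rfl, rfl⟩
      exact ⟨⟨2 * a + d * b, by rw [hd]; ring⟩, ⟨-b, by ring⟩⟩
    · rintro ⟨⟨s, hs⟩, ⟨t, ht⟩⟩
      refine ⟨h * (s + d * t), -t, ?_, ?_⟩
      · linear_combination (-h) * hs - h * ht - h * t * hd + x * hh
      · linear_combination (-h) * hs - h * ht - h * t * hd + x * hh + ht
  · obtain ⟨d, hd⟩ := pow_dvd_pow (p : ZMod (p ^ m)) (show m - k ≤ k by omega)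
    simp only [Submodule.mem_span_pair, Prod.smul_mk, Prod.mk_add_mk, smul_eq_mul, Prod.mk.injEq]
    constructor
    · rintro ⟨a, b, rfl, rfl⟩
      exact ⟨⟨b, by ring⟩, ⟨2 * a - d * b, by rw [hd]; ring⟩⟩
    · rintro ⟨⟨s, hs⟩, ⟨t, ht⟩⟩
      refine ⟨h * (t + d * s), s, ?_, ?_⟩
      · linear_combination (-h) * hs - h * ht - h * s * hd + x * hh
      · linear_combination h * hs + h * ht + h * s * hd - x * hh - hs

lemma Lk_isLagrangian {p m k : ℕ} (hp : p.Prime) (hodd : Odd p) (hk : k ≤ m)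
    (v : ZMod (p ^ m) × ZMod (p ^ m)) :
    v ∈ Lk p m k ↔ ∀ w ∈ Lk p m k, v.1 * w.1 - v.2 * w.2 = 0 := by
  simp only [mem_Lk_iff hodd hk]
  constructor
  · rintro ⟨h₁, h₂⟩ w ⟨h₃, h₄⟩
    rw [← (isUnit_two_primePow (m := m) hodd).mul_right_eq_zero]
    linear_combination mul_eq_zero_of_primePow_dvd hk h₁ h₄ + mul_eq_zero_of_primePow_dvd hk h₃ h₂
  · intro h
    constructor
    · have h' := h ((p : ZMod (p ^ m)) ^ (m - k), -(p : ZMod (p ^ m)) ^ (m - k))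
        ⟨by simp, by simp⟩
      have hd := primePow_dvd_of_mul_eq_zero hp (i := m - k) (x := v.1 + v.2)
        (by linear_combination h')
      rwa [Nat.sub_sub_self hk] at hd
    · have h' := h ((p : ZMod (p ^ m)) ^ k, (p : ZMod (p ^ m)) ^ k) ⟨by simp, by simp⟩
      exact primePow_dvd_of_mul_eq_zero hp (by linear_combination h')

/-- In the hyperbolic coordinates `x + y`, `x - y` a Lagrangian submodule splits as a product. -/
lemma exists_eq_Lk_of_isLagrangian {p m : ℕ} (hp : p.Prime) (hodd : Odd p)
    {L : Submodule (ZMod (p ^ m)) (ZMod (p ^ m) × ZMod (p ^ m))}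
    (hL : ∀ v, v ∈ L ↔ ∀ w ∈ L, v.1 * w.1 - v.2 * w.2 = 0) : ∃ k ≤ m, L = Lk p m k := by
  have h2 := isUnit_two_primePow (m := m) hodd
  have hsplit : ∀ v ∈ L, ∀ w ∈ L, (v.1 + v.2) * (w.1 - w.2) = 0 := by
    intro v hv w hw
    have hvv := (hL v).mp hv v hv
    have hww := (hL w).mp hw w hw
    have hvw := (hL v).mp hv w hw
    rcases primePow_dvd_total hp (v.1 + v.2) (w.1 + w.2) with ⟨c, hc⟩ | ⟨c, hc⟩
    · linear_combination 2 * hvw - c * hvv - (v.1 - v.2) * hc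
    · linear_combination c * hww + (w.1 - w.2) * hc
  obtain ⟨k, hk, hI⟩ := exists_mem_ideal_iff_primePow_dvd hp
    (L.comap ((LinearMap.id : ZMod (p ^ m) →ₗ[ZMod (p ^ m)] ZMod (p ^ m)).prod LinearMap.id))
  replace hI : ∀ x, (x, x) ∈ L ↔ (p : ZMod (p ^ m)) ^ k ∣ x := hI
  have hdvd : ∀ v ∈ L, (p : ZMod (p ^ m)) ^ k ∣ v.1 + v.2 ∧
      (p : ZMod (p ^ m)) ^ (m - k) ∣ v.1 - v.2 := by
    intro v hv
    refine ⟨(hI _).mp ((hL _).mpr fun w hw => ?_), primePow_dvd_of_mul_eq_zero hp ?_⟩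
    · linear_combination hsplit v hv w hw
    · linear_combination (hL _).mp ((hI _).mpr dvd_rfl) v hv
  refine ⟨k, hk, le_antisymm (fun v hv => (mem_Lk_iff hodd hk v).mpr (hdvd v hv))
    fun v hv => (hL v).mpr fun w hw => ?_⟩
  exact (Lk_isLagrangian hp hodd hk v).mp hv w ((mem_Lk_iff hodd hk w).mpr (hdvd w hw))

lemma le_of_Lk_le {p m k k' : ℕ} (hp : p.Prime) (hodd : Odd p) (hk : k ≤ m) (hk' : k' ≤ m)
    (h : Lk p m k ≤ Lk p m k') : k' ≤ k := by
  have hmem : ((p : ZMod (p ^ m)) ^ k, (p : ZMod (p ^ m)) ^ k) ∈ Lk p m k :=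
    (mem_Lk_iff hodd hk _).mpr ⟨by simp, by simp⟩
  have hd := ((mem_Lk_iff hodd hk' _).mp (h hmem)).1
  rw [← two_mul, (isUnit_two_primePow hodd).dvd_mul_left] at hd
  exact le_of_primePow_dvd_primePow hp hk' hd

/-- Classification of surface operators for `G = Z_{p^m}`: a submodule `L` of
`(ZMod p^m)²` is Lagrangian with respect to `b((a,b),(c,d)) = ac − bd` iff `L = L_k` for
some `0 ≤ k ≤ m`; moreover `L₀, …, L_m` are pairwise distinct, so there are exactly
`m + 1` Lagrangian submodules. -/
theorem surface_operator_classification (p m : ℕ) (hp : p.Prime) (hodd : Odd p)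
    (hm : 1 ≤ m) :
    (∀ L : Submodule (ZMod (p ^ m)) (ZMod (p ^ m) × ZMod (p ^ m)),
      (∀ v, v ∈ L ↔ ∀ w ∈ L, v.1 * w.1 - v.2 * w.2 = 0) ↔ ∃ k ≤ m, L = Lk p m k) ∧
    (∀ k ≤ m, ∀ k' ≤ m, Lk p m k = Lk p m k' → k = k') ∧
    Nat.card {L : Submodule (ZMod (p ^ m)) (ZMod (p ^ m) × ZMod (p ^ m)) //
      ∀ v, v ∈ L ↔ ∀ w ∈ L, v.1 * w.1 - v.2 * w.2 = 0} = m + 1 := by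
  have hclass : ∀ L : Submodule (ZMod (p ^ m)) (ZMod (p ^ m) × ZMod (p ^ m)),
      (∀ v, v ∈ L ↔ ∀ w ∈ L, v.1 * w.1 - v.2 * w.2 = 0) ↔ ∃ k ≤ m, L = Lk p m k := by
    refine fun L => ⟨exists_eq_Lk_of_isLagrangian hp hodd, ?_⟩
    rintro ⟨k, hk, rfl⟩
    exact Lk_isLagrangian hp hodd hk
  have hinj : ∀ k ≤ m, ∀ k' ≤ m, Lk p m k = Lk p m k' → k = k' := fun k hk k' hk' h =>
    le_antisymm (le_of_Lk_le hp hodd hk' hk h.ge) (le_of_Lk_le hp hodd hk hk' h.le)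
  refine ⟨hclass, hinj, ?_⟩
  rw [← Nat.card_fin (m + 1)]
  refine (Nat.card_eq_of_bijective (fun k : Fin (m + 1) => ⟨Lk p m k,
    (hclass _).mpr ⟨k, Nat.lt_succ_iff.mp k.2, rfl⟩⟩) ⟨fun k k' h => ?_, ?_⟩).symm
  · exact Fin.ext (hinj k (Nat.lt_succ_iff.mp k.2) k' (Nat.lt_succ_iff.mp k'.2)
      (Subtype.ext_iff.mp h))
  · rintro ⟨L, hL⟩
    obtain ⟨k, hk, rfl⟩ := (hclass L).mp hL
    exact ⟨⟨k, Nat.lt_succ_iff.mpr hk⟩, rfl⟩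
end

section
/- (Inverse of the Toeplitz intersection matrix.) Let x be a real number with x ≠ 0 and x² ≠ 1, and let m ≥ 0. Define matrices D and E indexed by Fin (m+1) × Fin (m+1) with real entries by D_{ij} = x^{−|i−j|} and E_{ij} = (x/(x²−1)) · ( (x + x^{−1})·δ_{ij} − x^{−1}·δ_{ij}·(δ_{i,0} + δ_{i,m}) − δ_{|i−j|,1} ), where δ denotes the Kronecker delta. Then D · E = I, the identity matrix; in particular D is invertible with inverse E. -/
open Matrix

/-- Summing `f` over the neighbours of `j` in the path `0, 1, …, m`. -/
theorem sum_fin_mul_ite_dist_eq_one (f : ℤ → ℝ) {m j : ℕ} (hj : j ≤ m) :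
    ∑ k : Fin (m + 1), f k.1 * (if Nat.dist k.1 j = 1 then (1 : ℝ) else 0) =
      (if j = 0 then 0 else f (j - 1)) + (if j = m then 0 else f (j + 1)) := by
  have hsplit (k : ℕ) : f k * (if Nat.dist k j = 1 then (1 : ℝ) else 0) =
      (if k = j - 1 then (if j = 0 then 0 else f (j - 1)) else 0) +
        (if k = j + 1 then f (j + 1) else 0) := by
    rcases lt_trichotomy (k + 1) j with h | h | h
    · simp [Nat.dist, show ¬ k - j + (j - k) = 1 by omega, show k ≠ j - 1 by omega,
        show k ≠ j + 1 by omega]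
    · subst h
      simp [Nat.dist, show k ≠ k + 1 + 1 by omega]
    · by_cases hk : k = j + 1
      · subst hk
        simp [Nat.dist, show j + 1 ≠ j - 1 by omega]
      · have hkj : k = j - 1 → j = 0 := by omega
        simp +contextual [Nat.dist, show ¬ k - j + (j - k) = 1 by omega, hk, hkj]
  rw [Fin.sum_univ_eq_sum_range
    (fun k : ℕ => f k * (if Nat.dist k j = 1 then (1 : ℝ) else 0)) (m + 1)]
  simp only [hsplit, Finset.sum_add_distrib, Finset.sum_ite_eq', Finset.mem_range]
  rw [if_pos (by omega : j - 1 < m + 1)]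
  congr 1
  by_cases h : j = m
  · simp [h]
  · simp [h, show j < m by omega]

/-- The function `k ↦ x ^ (-|i - k|)` is, up to a factor, the Green's function of the
second-order difference operator on `ℤ`. -/
theorem zpow_neg_abs_sub_second_difference {x : ℝ} (hx : x ≠ 0) (i j : ℤ) :
    (x + x⁻¹) * x ^ (-|i - j|) - x ^ (-|i - (j - 1)|) - x ^ (-|i - (j + 1)|) =
      if i = j then x - x⁻¹ else 0 := by
  rcases lt_trichotomy i j with h | h | h
  · rw [if_neg h.ne, abs_of_neg (by omega), abs_of_nonpos (by omega : i - (j - 1) ≤ 0),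
      abs_of_neg (by omega), show -(-(i - (j - 1))) = -(-(i - j)) + 1 by ring,
      show -(-(i - (j + 1))) = -(-(i - j)) - 1 by ring, zpow_add_one₀ hx, zpow_sub_one₀ hx]
    ring
  · subst h
    simp
  · rw [if_neg h.ne', abs_of_pos (by omega), abs_of_pos (by omega : 0 < i - (j - 1)),
      abs_of_nonneg (by omega), show -(i - (j - 1)) = -(i - j) - 1 by ring,
      show -(i - (j + 1)) = -(i - j) + 1 by ring, zpow_add_one₀ hx, zpow_sub_one₀ hx]
    ring

/-- Inverse of the Toeplitz intersection matrix: for real `x` with `x ≠ 0`, `x² ≠ 1`,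
the matrix `D` with `D_{ij} = x^{−|i−j|}` on `Fin (m+1)` satisfies `D · E = I`, where
`E_{ij} = (x/(x²−1))·((x + x⁻¹)δ_{ij} − x⁻¹ δ_{ij}(δ_{i,0} + δ_{i,m}) − δ_{|i−j|,1})`. -/
theorem toeplitz_inverse (x : ℝ) (hx : x ≠ 0) (hx2 : x ^ 2 ≠ 1) (m : ℕ) :
    (Matrix.of fun i j : Fin (m + 1) => x ^ (-(Nat.dist i.1 j.1 : ℤ))) *
      (Matrix.of fun i j : Fin (m + 1) =>
        (x / (x ^ 2 - 1)) *
          ((x + x⁻¹) * (if i = j then (1 : ℝ) else 0) -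
            x⁻¹ * (if i = j then (1 : ℝ) else 0) *
              ((if i.1 = 0 then (1 : ℝ) else 0) + (if i.1 = m then (1 : ℝ) else 0)) -
            (if Nat.dist i.1 j.1 = 1 then (1 : ℝ) else 0))) = 1 := by
  ext i j
  obtain ⟨f, hf⟩ : ∃ f : ℤ → ℝ, f = fun k => x ^ (-|(i.1 : ℤ) - k|) := ⟨_, rfl⟩
  have hdist (k : Fin (m + 1)) : x ^ (-(Nat.dist i.1 k.1 : ℤ)) = f k.1 := by
    rw [hf]
    congr 2
    rw [abs_eq_max_neg]
    unfold Nat.dist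
    omega
  have hj := j.is_lt
  have hi := i.is_lt
  -- the boundary corrections supply the two values of `f` just outside the path
  have hleft : j.1 = 0 → x⁻¹ * f j.1 = f (j.1 - 1) := by
    intro h
    simp only [hf]
    rw [mul_comm, ← zpow_sub_one₀ hx]
    congr 1
    rw [abs_eq_max_neg, abs_eq_max_neg]
    omega
  have hright : j.1 = m → x⁻¹ * f j.1 = f (j.1 + 1) := by
    intro h
    simp only [hf]
    rw [mul_comm, ← zpow_sub_one₀ hx]
    congr 1
    rw [abs_eq_max_neg, abs_eq_max_neg]
    omega
  have hgreen := zpow_neg_abs_sub_second_difference hx i.1 j.1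
  have hentry (k : Fin (m + 1)) : f k.1 * ((x / (x ^ 2 - 1)) *
      ((x + x⁻¹) * (if k = j then (1 : ℝ) else 0) -
        x⁻¹ * (if k = j then (1 : ℝ) else 0) *
          ((if k.1 = 0 then (1 : ℝ) else 0) + (if k.1 = m then (1 : ℝ) else 0)) -
        (if Nat.dist k.1 j.1 = 1 then (1 : ℝ) else 0))) =
      (x / (x ^ 2 - 1)) * ((if k = j then (x + x⁻¹) * f j.1 - x⁻¹ * f j.1 *
          ((if j.1 = 0 then (1 : ℝ) else 0) + (if j.1 = m then (1 : ℝ) else 0)) else 0) -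
        f k.1 * (if Nat.dist k.1 j.1 = 1 then (1 : ℝ) else 0)) := by
    by_cases h : k = j
    · subst h
      simp only [if_true]
      ring
    · simp only [h, if_false]
      ring
  simp only [Matrix.mul_apply, Matrix.of_apply, hdist, hentry]
  rw [← Finset.mul_sum, Finset.sum_sub_distrib,
    sum_fin_mul_ite_dist_eq_one f (Nat.lt_succ_iff.mp hj), Finset.sum_ite_eq',
    if_pos (Finset.mem_univ j)]
  have hsum : (x + x⁻¹) * f j.1 - x⁻¹ * f j.1 *
        ((if j.1 = 0 then (1 : ℝ) else 0) + (if j.1 = m then (1 : ℝ) else 0)) -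
      ((if j.1 = 0 then 0 else f (j.1 - 1)) + (if j.1 = m then 0 else f (j.1 + 1))) =
      if (i.1 : ℤ) = j.1 then x - x⁻¹ else 0 := by
    rw [← hgreen]
    change _ = (x + x⁻¹) * (fun k : ℤ => x ^ (-|(i.1 : ℤ) - k|)) j.1 -
      (fun k : ℤ => x ^ (-|(i.1 : ℤ) - k|)) (j.1 - 1) -
      (fun k : ℤ => x ^ (-|(i.1 : ℤ) - k|)) (j.1 + 1)
    rw [← hf]
    split_ifs with h0 hm hm
    · linear_combination -hleft h0 - hright hm
    · linear_combination -hleft h0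
    · linear_combination -hright hm
    · ring
  rw [hsum, Matrix.one_apply]
  have hx2' : x ^ 2 - 1 ≠ 0 := sub_ne_zero.mpr hx2
  by_cases h : i = j
  · rw [if_pos (by rw [h]), if_pos h]
    field_simp
  · rw [if_neg (by rwa [Nat.cast_inj, Fin.val_inj]), if_neg h, mul_zero]
end
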